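/- Let d ≥ 1, let h : ℝ^d → ℝ be smooth and ℤ^d-periodic, let Ω = {(x,y) ∈ ℝ^d × ℝ : y < h(x)}, and let φ : closure(Ω) → ℝ be smooth, ℤ^d-periodic in x, harmonic in Ω (Δ_{x,y} φ = 0), with boundary value φ(x,h(x)) = h(x) for all x, such that every partial derivative ∂_x^α ∂_y^β φ of positive order is square-integrable on the fundamental domain of Ω and converges to 0 uniformly in x as y → −∞. Set Q(x,y) = φ(x,y) − y, κ(x) = −div( ∇h / √(1+|∇h|^2) )(x), and (G(h)h)(x) = ∂_y φ(x,h(x)) − ∇h(x)·∇_x φ(x,h(x)). Then ∫_{𝕋^d} κ(x) (G(h)h)(x) dx = ∫∫_{Ω} ( |∇_{x,y}Q|^2 |∇^2_{x,y}Q|^2 − |∇_{x,y}Q · ∇_{x,y}∇_{x,y}Q|^2 ) / |∇_{x,y}Q|^3 dy dx, and in particular ∫_{𝕋^d} κ (G(h)h) dx ≥ 0. -/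

import Mathlib

open MeasureTheory Real

/-- Horizontal partial derivative `∂ᵢ f` of a function on `ℝᵈ`. -/
noncomputable def pder {d : ℕ} (i : Fin d) (f : EuclideanSpace ℝ (Fin d) → ℝ)
    (x : EuclideanSpace ℝ (Fin d)) : ℝ :=
  fderiv ℝ f x (EuclideanSpace.single i 1)

/-- Horizontal partial derivative `∂_{xᵢ} f` of a function on `ℝᵈ × ℝ`. -/
noncomputable def pdx {d : ℕ} (i : Fin d) (f : EuclideanSpace ℝ (Fin d) × ℝ → ℝ)
    (p : EuclideanSpace ℝ (Fin d) × ℝ) : ℝ :=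
  fderiv ℝ f p (EuclideanSpace.single i 1, 0)

/-- Vertical partial derivative `∂_y f` of a function on `ℝᵈ × ℝ`. -/
noncomputable def pdy {d : ℕ} (f : EuclideanSpace ℝ (Fin d) × ℝ → ℝ)
    (p : EuclideanSpace ℝ (Fin d) × ℝ) : ℝ :=
  fderiv ℝ f p (0, 1)

/-- The fundamental domain `[0,1)^d` of the torus `𝕋^d`. -/
def fundDom (d : ℕ) : Set (EuclideanSpace ℝ (Fin d)) :=
  {x | ∀ i, 0 ≤ x i ∧ x i < 1}

/-- `ℤ^d`-periodicity of a function on `ℝ^d`. -/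
def ZPeriodic {d : ℕ} (f : EuclideanSpace ℝ (Fin d) → ℝ) : Prop :=
  ∀ (x : EuclideanSpace ℝ (Fin d)) (k : Fin d → ℤ),
    f (x + (WithLp.equiv 2 (Fin d → ℝ)).symm (fun i => (k i : ℝ))) = f x

/-- `ℤ^d`-periodicity in the horizontal variable of a function on `ℝᵈ × ℝ`. -/
def ZPeriodicX {d : ℕ} (f : EuclideanSpace ℝ (Fin d) × ℝ → ℝ) : Prop :=
  ∀ (x : EuclideanSpace ℝ (Fin d)) (y : ℝ) (k : Fin d → ℤ),
    f (x + (WithLp.equiv 2 (Fin d → ℝ)).symm (fun i => (k i : ℝ)), y) = f (x, y)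

/-- Squared norm of the full gradient `|∇_{x,y} f|²` on `ℝᵈ × ℝ`. -/
noncomputable def fullGradSq {d : ℕ} (f : EuclideanSpace ℝ (Fin d) × ℝ → ℝ)
    (p : EuclideanSpace ℝ (Fin d) × ℝ) : ℝ :=
  (∑ i, (pdx i f p) ^ 2) + (pdy f p) ^ 2

/-- Squared Frobenius norm of the full Hessian `|∇²_{x,y} f|²` on `ℝᵈ × ℝ`,
summing over all `d+1` coordinates. -/
noncomputable def fullHessSq {d : ℕ} (f : EuclideanSpace ℝ (Fin d) × ℝ → ℝ)
    (p : EuclideanSpace ℝ (Fin d) × ℝ) : ℝ :=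
  (∑ i, ∑ j, (pdx i (pdx j f) p) ^ 2) + (∑ i, (pdx i (pdy f) p) ^ 2)
    + (∑ j, (pdy (pdx j f) p) ^ 2) + (pdy (pdy f) p) ^ 2

/-- `|∇_{x,y}f · ∇_{x,y}∇_{x,y}f|² = ∑ᵢ (∑ⱼ (∂ⱼf)(∂ᵢ∂ⱼf))²`, indices over all
`d+1` coordinates. -/
noncomputable def gradDotHessSq {d : ℕ} (f : EuclideanSpace ℝ (Fin d) × ℝ → ℝ)
    (p : EuclideanSpace ℝ (Fin d) × ℝ) : ℝ :=
  (∑ i, ((∑ j, pdx j f p * pdx i (pdx j f) p) + pdy f p * pdx i (pdy f) p) ^ 2)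
    + ((∑ j, pdx j f p * pdy (pdx j f) p) + pdy f p * pdy (pdy f) p) ^ 2

/-- The mean curvature `κ = −div(∇h/√(1+|∇h|²))` of the graph of `h`. -/
noncomputable def curvature {d : ℕ} (h : EuclideanSpace ℝ (Fin d) → ℝ)
    (x : EuclideanSpace ℝ (Fin d)) : ℝ :=
  -(∑ i, pder i (fun y =>
      pder i h y / Real.sqrt (1 + ∑ j, (pder j h y) ^ 2)) x)

/-- The Dirichlet-to-Neumann term `G(h)h = ∂_yφ(x,h(x)) − ∇h·∇ₓφ(x,h(x))`, expressed
via the harmonic extension `φ` of `h`. -/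
noncomputable def DtNh {d : ℕ} (h : EuclideanSpace ℝ (Fin d) → ℝ)
    (φ : EuclideanSpace ℝ (Fin d) × ℝ → ℝ) (x : EuclideanSpace ℝ (Fin d)) : ℝ :=
  pdy φ (x, h x) - ∑ i, pder i h x * pdx i φ (x, h x)


noncomputable def ee (d : ℕ) : Option (Fin d) → EuclideanSpace ℝ (Fin d) × ℝ
  | some i => (EuclideanSpace.single i 1, 0)
  | none => (0, 1)

noncomputable def DD {d : ℕ} (a : Option (Fin d)) (f : EuclideanSpace ℝ (Fin d) × ℝ → ℝ)
    (p : EuclideanSpace ℝ (Fin d) × ℝ) : ℝ := fderiv ℝ f p (ee d a)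

lemma pdx_eq {d : ℕ} (i : Fin d) (f : EuclideanSpace ℝ (Fin d) × ℝ → ℝ) :
    pdx i f = DD (some i) f := rfl

lemma pdy_eq {d : ℕ} (f : EuclideanSpace ℝ (Fin d) × ℝ → ℝ) :
    pdy f = DD none f := rfl

lemma fullGradSq_eq {d : ℕ} (f : EuclideanSpace ℝ (Fin d) × ℝ → ℝ)
    (p : EuclideanSpace ℝ (Fin d) × ℝ) : fullGradSq f p = ∑ a, (DD a f p) ^ 2 := by
  rw [Fintype.sum_option, add_comm]; rfl

lemma fullHessSq_eq {d : ℕ} (f : EuclideanSpace ℝ (Fin d) × ℝ → ℝ)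
    (p : EuclideanSpace ℝ (Fin d) × ℝ) :
    fullHessSq f p = ∑ a, ∑ b, (DD a (DD b f) p) ^ 2 := by
  simp only [Fintype.sum_option, Finset.sum_add_distrib, fullHessSq, pdx_eq, pdy_eq]
  ring

lemma gradDotHessSq_eq {d : ℕ} (f : EuclideanSpace ℝ (Fin d) × ℝ → ℝ)
    (p : EuclideanSpace ℝ (Fin d) × ℝ) :
    gradDotHessSq f p = ∑ a, (∑ b, DD b f p * DD a (DD b f) p) ^ 2 := by
  simp only [Fintype.sum_option, gradDotHessSq, pdx_eq, pdy_eq]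
  rw [add_comm]
  congr 1
  · ring
  · refine Finset.sum_congr rfl fun i _ => ?_
    ring

lemma DD_contDiffAt {d : ℕ} (a : Option (Fin d)) {f : EuclideanSpace ℝ (Fin d) × ℝ → ℝ}
    {p : EuclideanSpace ℝ (Fin d) × ℝ} (hf : ContDiffAt ℝ (⊤ : ℕ∞) f p) :
    ContDiffAt ℝ (⊤ : ℕ∞) (DD a f) p := by
  have : ContDiffAt ℝ (⊤ : ℕ∞) (fderiv ℝ f) p := hf.fderiv_right (by simp)
  exact this.clm_apply contDiffAt_const

lemma DD_contDiff {d : ℕ} (a : Option (Fin d)) {f : EuclideanSpace ℝ (Fin d) × ℝ → ℝ}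
    (hf : ContDiff ℝ (⊤ : ℕ∞) f) :
    ContDiff ℝ (⊤ : ℕ∞) (DD a f) :=
  contDiff_iff_contDiffAt.2 fun _ => DD_contDiffAt a hf.contDiffAt

lemma DD_comm {d : ℕ} (a b : Option (Fin d)) {f : EuclideanSpace ℝ (Fin d) × ℝ → ℝ}
    (hf : ContDiff ℝ (⊤ : ℕ∞) f) (p : EuclideanSpace ℝ (Fin d) × ℝ) :
    DD a (DD b f) p = DD b (DD a f) p := by
  have hd : DifferentiableAt ℝ (fderiv ℝ f) p :=
    (hf.fderiv_right (m := (⊤ : ℕ∞)) (by simp)).differentiable (by simp) p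
  have key : ∀ a b : Option (Fin d), DD a (DD b f) p = fderiv ℝ (fderiv ℝ f) p (ee d a) (ee d b) := by
    intro a b
    have : DD b f = fun q => fderiv ℝ f q (ee d b) := rfl
    rw [DD, this, fderiv_clm_apply hd (by fun_prop)]
    simp
  rw [key, key]
  have := (hf.contDiffAt (x := p)).isSymmSndFDerivAt (by simp; exact WithTop.coe_le_coe.2 (le_top : (2:ℕ∞) ≤ ⊤))
  exact this _ _

lemma DD_periodic {d : ℕ} (a : Option (Fin d)) {f : EuclideanSpace ℝ (Fin d) × ℝ → ℝ}
    (hf : ZPeriodicX f) : ZPeriodicX (DD a f) := by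
  intro x y k
  set v : EuclideanSpace ℝ (Fin d) := (WithLp.equiv 2 (Fin d → ℝ)).symm (fun i => (k i : ℝ))
  have h1 : (fun q : EuclideanSpace ℝ (Fin d) × ℝ => f (q + (v, 0))) = f := by
    funext q
    have := hf q.1 q.2 k
    convert this using 2
    ext <;> simp [v]
  have h2 := fderiv_comp_add_right (𝕜 := ℝ) (f := f) (x := (x, y)) (v, (0:ℝ))
  rw [h1] at h2
  unfold DD
  rw [h2]; simp [v]

lemma pder_contDiff {d : ℕ} (i : Fin d) {f : EuclideanSpace ℝ (Fin d) → ℝ}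
    (hf : ContDiff ℝ (⊤ : ℕ∞) f) : ContDiff ℝ (⊤ : ℕ∞) (pder i f) :=
  (hf.fderiv_right (m := (⊤ : ℕ∞)) (by simp)).clm_apply contDiff_const

lemma pder_periodic {d : ℕ} (i : Fin d) {f : EuclideanSpace ℝ (Fin d) → ℝ}
    (hf : ZPeriodic f) : ZPeriodic (pder i f) := by
  intro x k
  set v : EuclideanSpace ℝ (Fin d) := (WithLp.equiv 2 (Fin d → ℝ)).symm (fun i => (k i : ℝ))
  have h1 : (fun q : EuclideanSpace ℝ (Fin d) => f (q + v)) = f := by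
    funext q
    exact hf q k
  have h2 := fderiv_comp_add_right (𝕜 := ℝ) (f := f) (x := x) v
  rw [h1] at h2
  unfold pder
  rw [h2]

/-- derivative of composition with the sheared graph. -/
lemma pder_comp_graph {d : ℕ} (i : Fin d) {f : EuclideanSpace ℝ (Fin d) × ℝ → ℝ}
    {h : EuclideanSpace ℝ (Fin d) → ℝ} (hh : Differentiable ℝ h) (s : ℝ)
    (x : EuclideanSpace ℝ (Fin d)) (hf : DifferentiableAt ℝ f (x, h x + s)) :
    pder i (fun x => f (x, h x + s)) x
      = DD (some i) f (x, h x + s) + pder i h x * DD none f (x, h x + s) := by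
  have h1 : HasFDerivAt (fun x => (x, h x + s))
      ((ContinuousLinearMap.id ℝ _).prod (fderiv ℝ h x)) x :=
    (hasFDerivAt_id x).prodMk ((hh x).hasFDerivAt.add_const s)
  have h2 := hf.hasFDerivAt.comp x h1
  have h3 : fderiv ℝ (fun x => f (x, h x + s)) x = _ := h2.fderiv
  unfold pder DD
  rw [h3]
  simp only [ContinuousLinearMap.comp_apply, ContinuousLinearMap.prod_apply,
    ContinuousLinearMap.id_apply, ee]
  rw [← smul_eq_mul, ← map_smul, ← map_add]
  simp

lemma hasDerivAt_vert {d : ℕ} {f : EuclideanSpace ℝ (Fin d) × ℝ → ℝ}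
    (x : EuclideanSpace ℝ (Fin d)) (y : ℝ) (hf : DifferentiableAt ℝ f (x, y)) :
    HasDerivAt (fun t => f (x, t)) (DD none f (x, y)) y := by
  have h1 : HasDerivAt (fun t : ℝ => (x, t)) ((0 : EuclideanSpace ℝ (Fin d)), (1:ℝ)) y :=
    (hasDerivAt_const y x).prodMk (hasDerivAt_id y)
  exact hf.hasFDerivAt.comp_hasDerivAt y h1

lemma hasDerivAt_line {d : ℕ} {f : EuclideanSpace ℝ (Fin d) × ℝ → ℝ} (a : Option (Fin d))
    (p : EuclideanSpace ℝ (Fin d) × ℝ) (hf : Differentiable ℝ f) (t : ℝ) :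
    HasDerivAt (fun t : ℝ => f (p + t • ee d a)) (DD a f (p + t • ee d a)) t := by
  have h1 : HasDerivAt (fun t : ℝ => p + t • ee d a) (ee d a) t := by
    simpa using ((hasDerivAt_id t).smul_const (ee d a)).const_add p
  exact (hf _).hasFDerivAt.comp_hasDerivAt t h1

lemma DD_DD_nonpos_of_isLocalMax {d : ℕ} {f : EuclideanSpace ℝ (Fin d) × ℝ → ℝ} (a : Option (Fin d))
    (p : EuclideanSpace ℝ (Fin d) × ℝ) (hf : ContDiff ℝ (⊤ : ℕ∞) f) (hm : IsLocalMax f p) :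
    DD a (DD a f) p ≤ 0 := by
  by_contra! hpos
  have hf1 : Differentiable ℝ f := hf.differentiable (by simp)
  have hf2 : Differentiable ℝ (DD a f) := (DD_contDiff a hf).differentiable (by simp)
  set g : ℝ → ℝ := fun t => f (p + t • ee d a) with hg
  have d1 : deriv g = fun t => DD a f (p + t • ee d a) :=
    funext fun t => (hasDerivAt_line a p hf1 t).deriv
  have d2 : deriv (deriv g) = fun t => DD a (DD a f) (p + t • ee d a) := by
    rw [d1]
    exact funext fun t => (hasDerivAt_line a p hf2 t).deriv
  have hgc : Continuous g := by
    rw [hg]; exact hf.continuous.comp (by fun_prop)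
  have hmax : IsLocalMax g 0 := by
    have hc : ContinuousAt (fun t : ℝ => p + t • ee d a) 0 := by fun_prop
    have h0 : p + (0:ℝ) • ee d a = p := by simp
    have : Filter.Tendsto (fun t : ℝ => p + t • ee d a) (nhds 0) (nhds p) := by
      simpa [h0] using hc.tendsto
    have := this.eventually hm
    simpa [IsLocalMax, IsMaxFilter, hg] using this
  have hd0 : deriv g 0 = 0 := hmax.deriv_eq_zero
  have hdd : deriv (deriv g) 0 > 0 := by rw [d2]; simpa using hpos
  have hmin : IsLocalMin g 0 := isLocalMin_of_deriv_deriv_pos hdd hd0 hgc.continuousAt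
  have hconst : g =ᶠ[nhds 0] fun _ => g 0 := by
    filter_upwards [hmax, hmin] with t h1 h2
    exact le_antisymm h1 h2
  have := hconst.deriv.deriv_eq
  simp at this
  simp [this] at hdd

/-- closed unit cube -/
def cube (d : ℕ) : Set (EuclideanSpace ℝ (Fin d)) := {x | ∀ i, 0 ≤ x i ∧ x i ≤ 1}

lemma cube_compact (d : ℕ) : IsCompact (cube d) := by
  have h1 : IsCompact (Set.Icc (0 : Fin d → ℝ) 1) := isCompact_Icc
  have h2 := h1.image (PiLp.continuous_toLp 2 (fun _ : Fin d => ℝ))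
  convert h2 using 1
  ext x
  constructor
  · intro hx
    exact ⟨x.ofLp, ⟨fun i => (hx i).1, fun i => (hx i).2⟩, rfl⟩
  · rintro ⟨y, hy, rfl⟩ i
    exact ⟨hy.1 i, hy.2 i⟩

lemma fundDom_subset_cube (d : ℕ) : fundDom d ⊆ cube d := fun _ hx i => ⟨(hx i).1, (hx i).2.le⟩

lemma exists_shift {d : ℕ} (x : EuclideanSpace ℝ (Fin d)) : ∃ k : Fin d → ℤ,
    x + (WithLp.equiv 2 (Fin d → ℝ)).symm (fun i => (k i : ℝ)) ∈ fundDom d := by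
  refine ⟨fun i => -⌊x i⌋, fun i => ?_⟩
  have h1 := Int.floor_le (x i)
  have h2 := Int.lt_floor_add_one (x i)
  simp
  constructor <;> linarith

lemma periodic_bdd {d : ℕ} {f : EuclideanSpace ℝ (Fin d) → ℝ} (hf : Continuous f)
    (hp : ZPeriodic f) : ∃ C, 0 < C ∧ ∀ x, |f x| ≤ C := by
  obtain ⟨C, hC⟩ := (cube_compact d).exists_bound_of_continuousOn hf.continuousOn
  refine ⟨max C 1, by positivity, fun x => ?_⟩
  obtain ⟨k, hk⟩ := exists_shift x
  rw [← hp x k]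
  exact (hC _ (fundDom_subset_cube d hk)).trans (le_max_left _ _)

lemma strip_compact {d : ℕ} {l u : EuclideanSpace ℝ (Fin d) → ℝ} (hl : Continuous l)
    (hu : Continuous u) :
    IsCompact {p : EuclideanSpace ℝ (Fin d) × ℝ | p.1 ∈ cube d ∧ l p.1 ≤ p.2 ∧ p.2 ≤ u p.1} := by
  obtain ⟨A, hA⟩ := (cube_compact d).exists_bound_of_continuousOn hl.continuousOn
  obtain ⟨B, hB⟩ := (cube_compact d).exists_bound_of_continuousOn hu.continuousOn
  refine ((cube_compact d).prod (isCompact_Icc (a := -A) (b := B))).of_isClosed_subset ?_ ?_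
  · refine IsClosed.inter ((cube_compact d).isClosed.preimage continuous_fst) ?_
    exact (isClosed_le (hl.comp continuous_fst) continuous_snd).inter
      (isClosed_le continuous_snd (hu.comp continuous_fst))
  · rintro p ⟨h1, h2, h3⟩
    have a1 := hA _ h1
    have a2 := hB _ h1
    rw [Real.norm_eq_abs, abs_le] at a1 a2
    exact ⟨h1, by linarith, by linarith⟩

lemma max_principle {d : ℕ} {h : EuclideanSpace ℝ (Fin d) → ℝ} (hh : Continuous h)
    (hper : ZPeriodic h) {f : EuclideanSpace ℝ (Fin d) × ℝ → ℝ} (hf : ContDiff ℝ (⊤ : ℕ∞) f)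
    (hfp : ZPeriodicX f) (Y m : ℝ)
    (hsub : ∀ p : EuclideanSpace ℝ (Fin d) × ℝ, Y < p.2 → p.2 < h p.1 → 0 < ∑ a, DD a (DD a f) p)
    (hbot : ∀ x, f (x, Y) ≤ m) (htop : ∀ x, f (x, h x) ≤ m) (x : EuclideanSpace ℝ (Fin d))
    (y : ℝ) (h1 : Y ≤ y) (h2 : y ≤ h x) : f (x, y) ≤ m := by
  have hK := strip_compact (d := d) (l := fun _ => Y) continuous_const hh
  set K := {p : EuclideanSpace ℝ (Fin d) × ℝ | p.1 ∈ cube d ∧ Y ≤ p.2 ∧ p.2 ≤ h p.1} with hKdef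
  have hred : ∀ (x : EuclideanSpace ℝ (Fin d)) (y : ℝ), Y ≤ y → y ≤ h x →
      ∃ p ∈ K, f p = f (x, y) := by
    intro x y h1 h2
    obtain ⟨k, hk⟩ := exists_shift x
    exact ⟨(_, y), ⟨fundDom_subset_cube d hk, h1, by rw [hper x k]; exact h2⟩, hfp x y k⟩
  obtain ⟨p0, hp0, -⟩ := hred x y h1 h2
  obtain ⟨p, hp, hmax⟩ := hK.exists_isMaxOn ⟨p0, hp0⟩ hf.continuous.continuousOn
  have hall : ∀ (x : EuclideanSpace ℝ (Fin d)) (y : ℝ), Y ≤ y → y ≤ h x → f (x, y) ≤ f p := by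
    intro x y h1 h2
    obtain ⟨q, hq, e⟩ := hred x y h1 h2
    rw [← e]; exact hmax hq
  refine (hall x y h1 h2).trans ?_
  obtain ⟨px, py⟩ := p
  obtain ⟨-, k1, k2⟩ := hp
  simp only at k1 k2
  rcases k1.eq_or_lt with e | k1
  · subst e; exact hbot _
  rcases k2.eq_or_lt with e | k2
  · rw [e]; exact htop _
  exfalso
  have hloc : IsLocalMax f (px, py) := by
    have hopen : IsOpen {q : EuclideanSpace ℝ (Fin d) × ℝ | Y < q.2 ∧ q.2 < h q.1} :=
      (isOpen_lt continuous_const continuous_snd).inter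
        (isOpen_lt continuous_snd (hh.comp continuous_fst))
    filter_upwards [hopen.mem_nhds (x := (px, py)) ⟨k1, k2⟩] with q hq
    exact hall q.1 q.2 hq.1.le hq.2.le
  have := hsub (px, py) k1 k2
  have h3 : ∑ a, DD a (DD a f) (px, py) ≤ 0 :=
    Finset.sum_nonpos fun a _ => DD_DD_nonpos_of_isLocalMax a _ hf hloc
  linarith


section
variable {d : ℕ}

lemma DD_add (a : Option (Fin d)) {f g : EuclideanSpace ℝ (Fin d) × ℝ → ℝ}
    {p : EuclideanSpace ℝ (Fin d) × ℝ} (hf : DifferentiableAt ℝ f p) (hg : DifferentiableAt ℝ g p) :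
    DD a (fun q => f q + g q) p = DD a f p + DD a g p := by
  unfold DD; rw [fderiv_fun_add hf hg]; rfl

lemma DD_sub (a : Option (Fin d)) {f g : EuclideanSpace ℝ (Fin d) × ℝ → ℝ}
    {p : EuclideanSpace ℝ (Fin d) × ℝ} (hf : DifferentiableAt ℝ f p) (hg : DifferentiableAt ℝ g p) :
    DD a (fun q => f q - g q) p = DD a f p - DD a g p := by
  unfold DD; rw [fderiv_fun_sub hf hg]; rfl

lemma DD_mul (a : Option (Fin d)) {f g : EuclideanSpace ℝ (Fin d) × ℝ → ℝ}
    {p : EuclideanSpace ℝ (Fin d) × ℝ} (hf : DifferentiableAt ℝ f p) (hg : DifferentiableAt ℝ g p) :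
    DD a (fun q => f q * g q) p = f p * DD a g p + g p * DD a f p := by
  unfold DD; rw [fderiv_fun_mul hf hg]; simp

lemma DD_const (a : Option (Fin d)) (c : ℝ) (p : EuclideanSpace ℝ (Fin d) × ℝ) :
    DD a (fun _ => c) p = 0 := by
  unfold DD; simp

lemma DD_const_mul (a : Option (Fin d)) (c : ℝ) {g : EuclideanSpace ℝ (Fin d) × ℝ → ℝ}
    {p : EuclideanSpace ℝ (Fin d) × ℝ} (hg : DifferentiableAt ℝ g p) :
    DD a (fun q => c * g q) p = c * DD a g p := by
  rw [DD_mul a (by fun_prop) hg, DD_const]; ring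

lemma DD_sum {ι : Type*} (s : Finset ι) (a : Option (Fin d))
    {f : ι → EuclideanSpace ℝ (Fin d) × ℝ → ℝ}
    {p : EuclideanSpace ℝ (Fin d) × ℝ} (hf : ∀ i, DifferentiableAt ℝ (f i) p) :
    DD a (fun q => ∑ i ∈ s, f i q) p = ∑ i ∈ s, DD a (f i) p := by
  unfold DD; rw [fderiv_fun_sum fun i _ => hf i]; simp

lemma DD_exp (a : Option (Fin d)) {f : EuclideanSpace ℝ (Fin d) × ℝ → ℝ}
    {p : EuclideanSpace ℝ (Fin d) × ℝ} (hf : DifferentiableAt ℝ f p) :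
    DD a (fun q => Real.exp (f q)) p = Real.exp (f p) * DD a f p := by
  unfold DD; rw [fderiv_exp hf]; simp

lemma DD_snd (a : Option (Fin d)) (p : EuclideanSpace ℝ (Fin d) × ℝ) :
    DD a (fun q => q.2) p = (ee d a).2 := by
  unfold DD; rw [fderiv_snd]; rfl

lemma DD_some_fst (i : Fin d) {u : EuclideanSpace ℝ (Fin d) → ℝ} (hu : Differentiable ℝ u)
    (p : EuclideanSpace ℝ (Fin d) × ℝ) :
    DD (some i) (fun q => u q.1) p = pder i u p.1 := by
  unfold DD pder
  have := ((hu p.1).hasFDerivAt.comp p hasFDerivAt_fst).fderiv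
  simp only [Function.comp_def] at this
  rw [this]; simp [ee]

lemma DD_none_fst {u : EuclideanSpace ℝ (Fin d) → ℝ} (hu : Differentiable ℝ u)
    (p : EuclideanSpace ℝ (Fin d) × ℝ) :
    DD none (fun q => u q.1) p = 0 := by
  unfold DD
  have := ((hu p.1).hasFDerivAt.comp p hasFDerivAt_fst).fderiv
  simp only [Function.comp_def] at this
  rw [this]; simp [ee]

lemma DD_congr (a : Option (Fin d)) {f g : EuclideanSpace ℝ (Fin d) × ℝ → ℝ}
    {p : EuclideanSpace ℝ (Fin d) × ℝ} (h : f =ᶠ[nhds p] g) : DD a f p = DD a g p := by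
  unfold DD; rw [h.fderiv_eq]

lemma ee_norm (a : Option (Fin d)) : ‖ee d a‖ ≤ 1 := by
  cases a <;> simp [ee, Prod.norm_def]

lemma DD_le (a : Option (Fin d)) (f : EuclideanSpace ℝ (Fin d) × ℝ → ℝ)
    (p : EuclideanSpace ℝ (Fin d) × ℝ) : |DD a f p| ≤ ‖iteratedFDeriv ℝ 1 f p‖ := by
  have h1 := (iteratedFDeriv ℝ 1 f p).le_opNorm (fun _ => ee d a)
  rw [iteratedFDeriv_one_apply] at h1
  have h2 := ee_norm a
  have h3 := norm_nonneg (iteratedFDeriv ℝ 1 f p)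
  simp only [Finset.univ_unique, Finset.prod_const, Finset.card_singleton, pow_one] at h1
  exact h1.trans (mul_le_of_le_one_right h3 h2)

lemma DD_DD_eq (a b : Option (Fin d)) {f : EuclideanSpace ℝ (Fin d) × ℝ → ℝ}
    (hf : ContDiff ℝ (⊤ : ℕ∞) f) (p : EuclideanSpace ℝ (Fin d) × ℝ) :
    DD a (DD b f) p = fderiv ℝ (fderiv ℝ f) p (ee d a) (ee d b) := by
  have hd : DifferentiableAt ℝ (fderiv ℝ f) p :=
    (hf.fderiv_right (m := (⊤ : ℕ∞)) (by simp)).differentiable (by simp) p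
  have : DD b f = fun q => fderiv ℝ f q (ee d b) := rfl
  rw [DD, this, fderiv_clm_apply hd (by fun_prop)]
  simp

lemma DD_DD_le (a b : Option (Fin d)) {f : EuclideanSpace ℝ (Fin d) × ℝ → ℝ}
    (hf : ContDiff ℝ (⊤ : ℕ∞) f)
    (p : EuclideanSpace ℝ (Fin d) × ℝ) : |DD a (DD b f) p| ≤ ‖iteratedFDeriv ℝ 2 f p‖ := by
  have h1 := (iteratedFDeriv ℝ 2 f p).le_opNorm ![ee d a, ee d b]
  rw [iteratedFDeriv_two_apply] at h1
  simp [Fin.prod_univ_two] at h1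
  rw [DD_DD_eq a b hf]
  refine h1.trans ?_
  refine mul_le_of_le_one_right (norm_nonneg _) ?_
  exact mul_le_one₀ (ee_norm a) (norm_nonneg _) (ee_norm b)

lemma lap_DD (b : Option (Fin d)) {f : EuclideanSpace ℝ (Fin d) × ℝ → ℝ}
    (hf : ContDiff ℝ (⊤ : ℕ∞) f) (p : EuclideanSpace ℝ (Fin d) × ℝ) :
    ∑ a, DD a (DD a (DD b f)) p = DD b (fun q => ∑ a, DD a (DD a f) q) p := by
  rw [DD_sum]
  · refine Finset.sum_congr rfl fun a _ => ?_
    have : DD a (DD b f) = DD b (DD a f) := funext fun q => DD_comm a b hf q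
    rw [this, DD_comm a b (DD_contDiff a hf)]
  · intro a
    exact (DD_contDiff a (DD_contDiff a hf)).differentiable (by simp) p

lemma lap_DD_zero (b : Option (Fin d)) {f : EuclideanSpace ℝ (Fin d) × ℝ → ℝ}
    (hf : ContDiff ℝ (⊤ : ℕ∞) f) {h : EuclideanSpace ℝ (Fin d) → ℝ} (hh : Continuous h)
    (hharm : ∀ p : EuclideanSpace ℝ (Fin d) × ℝ, p.2 < h p.1 → ∑ a, DD a (DD a f) p = 0)
    (p : EuclideanSpace ℝ (Fin d) × ℝ) (hp : p.2 < h p.1) :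
    ∑ a, DD a (DD a (DD b f)) p = 0 := by
  rw [lap_DD b hf]
  have hopen : IsOpen {q : EuclideanSpace ℝ (Fin d) × ℝ | q.2 < h q.1} :=
    isOpen_lt continuous_snd (hh.comp continuous_fst)
  have : (fun q => ∑ a, DD a (DD a f) q) =ᶠ[nhds p] fun _ => 0 := by
    filter_upwards [hopen.mem_nhds hp] with q hq
    exact hharm q hq
  rw [DD_congr b this, DD_const]

lemma deriv_nonneg_of_left_max {g : ℝ → ℝ} {g' b l : ℝ} (hl : l < b) (hg : HasDerivAt g g' b)
    (hle : ∀ t, l ≤ t → t ≤ b → g t ≤ g b) : 0 ≤ g' := by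
  have h1 : HasDerivWithinAt g g' (Set.Iio b) b := hg.hasDerivWithinAt
  rw [hasDerivWithinAt_iff_tendsto_slope' (by simp)] at h1
  refine ge_of_tendsto h1 ?_
  filter_upwards [Ioo_mem_nhdsLT hl] with t ht
  rw [slope_def_field]
  exact div_nonneg_of_nonpos (by linarith [hle t ht.1.le ht.2.le]) (by linarith [ht.2])

lemma exp_shift_contDiff (α : ℝ) {h : EuclideanSpace ℝ (Fin d) → ℝ}
    (hsm : ContDiff ℝ (⊤ : ℕ∞) h) :
    ContDiff ℝ (⊤ : ℕ∞) (fun q : EuclideanSpace ℝ (Fin d) × ℝ => Real.exp (α * (h q.1 - q.2))) := by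
  have := hsm.comp (contDiff_fst (𝕜 := ℝ) (E := EuclideanSpace ℝ (Fin d)) (F := ℝ) (n := (⊤ : ℕ∞)))
  exact (contDiff_const.mul (this.sub contDiff_snd)).exp

lemma barrier_lap (α : ℝ) {h : EuclideanSpace ℝ (Fin d) → ℝ}
    (hsm : ContDiff ℝ (⊤ : ℕ∞) h) (p : EuclideanSpace ℝ (Fin d) × ℝ) :
    ∑ a, DD a (DD a (fun q : EuclideanSpace ℝ (Fin d) × ℝ => Real.exp (α * (h q.1 - q.2)))) p
      = Real.exp (α * (h p.1 - p.2)) * (α * (∑ i, pder i (pder i h) p.1) +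
        α ^ 2 * (1 + ∑ i, (pder i h p.1) ^ 2)) := by
  have hd : Differentiable ℝ h := hsm.differentiable (by simp)
  have hd1 : ∀ i, Differentiable ℝ (pder i h) := fun i => (pder_contDiff i hsm).differentiable (by simp)
  have hd' : Differentiable ℝ (fun q : EuclideanSpace ℝ (Fin d) × ℝ => h q.1) := by fun_prop
  have hd1' : ∀ i, Differentiable ℝ (fun q : EuclideanSpace ℝ (Fin d) × ℝ => pder i h q.1) :=
    fun i => (hd1 i).comp differentiable_fst
  have hE : Differentiable ℝ (fun q : EuclideanSpace ℝ (Fin d) × ℝ => Real.exp (α * (h q.1 - q.2))) :=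
    (exp_shift_contDiff α hsm).differentiable (by simp)
  have e1 : ∀ i, DD (some i) (fun q : EuclideanSpace ℝ (Fin d) × ℝ => Real.exp (α * (h q.1 - q.2)))
      = fun q => Real.exp (α * (h q.1 - q.2)) * (α * pder i h q.1) := by
    intro i; funext q
    rw [DD_exp _ (by fun_prop), DD_const_mul _ _ (by fun_prop), DD_sub _ (by fun_prop) (by fun_prop),
      DD_snd, DD_some_fst i hd]
    simp [ee]
  have e2 : DD none (fun q : EuclideanSpace ℝ (Fin d) × ℝ => Real.exp (α * (h q.1 - q.2)))
      = fun q => (-α) * Real.exp (α * (h q.1 - q.2)) := by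
    funext q
    rw [DD_exp _ (by fun_prop), DD_const_mul _ _ (by fun_prop), DD_sub _ (by fun_prop) (by fun_prop),
      DD_snd, DD_none_fst hd]
    simp [ee]; ring
  have e3 : ∀ i, DD (some i) (DD (some i) (fun q : EuclideanSpace ℝ (Fin d) × ℝ => Real.exp (α * (h q.1 - q.2)))) p
      = Real.exp (α * (h p.1 - p.2)) * (α * pder i (pder i h) p.1 + α ^ 2 * (pder i h p.1) ^ 2) := by
    intro i
    rw [e1, DD_mul _ (hE p) ((hd1' i p).const_mul α), DD_const_mul _ _ (hd1' i p), DD_some_fst i (hd1 i), e1]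
    ring
  have e4 : DD none (DD none (fun q : EuclideanSpace ℝ (Fin d) × ℝ => Real.exp (α * (h q.1 - q.2)))) p
      = Real.exp (α * (h p.1 - p.2)) * α ^ 2 := by
    rw [e2, DD_const_mul _ _ (hE p), e2]; ring
  rw [Fintype.sum_option, e4, Finset.sum_congr rfl fun i _ => e3 i, ← Finset.mul_sum,
    Finset.sum_add_distrib, ← Finset.mul_sum, ← Finset.mul_sum]
  ring

lemma barrier_none (α : ℝ) {h : EuclideanSpace ℝ (Fin d) → ℝ}
    (hsm : ContDiff ℝ (⊤ : ℕ∞) h) (p : EuclideanSpace ℝ (Fin d) × ℝ) :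
    DD none (fun q : EuclideanSpace ℝ (Fin d) × ℝ => Real.exp (α * (h q.1 - q.2))) p
      = (-α) * Real.exp (α * (h p.1 - p.2)) := by
  have hd : Differentiable ℝ h := hsm.differentiable (by simp)
  rw [DD_exp _ (by fun_prop), DD_const_mul _ _ (by fun_prop), DD_sub _ (by fun_prop) (by fun_prop),
      DD_snd, DD_none_fst hd]
  simp [ee]; ring

/-- quantitative Hopf lemma on the boundary. -/
lemma boundary_bound {h : EuclideanSpace ℝ (Fin d) → ℝ}
    (hsm : ContDiff ℝ (⊤ : ℕ∞) h) (hper : ZPeriodic h)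
    {Q : EuclideanSpace ℝ (Fin d) × ℝ → ℝ} (hQ : ContDiff ℝ (⊤ : ℕ∞) Q) (hQp : ZPeriodicX Q)
    (hharm : ∀ p : EuclideanSpace ℝ (Fin d) × ℝ, p.2 < h p.1 → ∑ a, DD a (DD a Q) p = 0)
    (hbd : ∀ x, Q (x, h x) = 0) (Y1 : ℝ) (hY1 : ∀ x y, y ≤ Y1 → DD none Q (x, y) ≤ -(1/2)) :
    ∃ c > 0, ∀ x, DD none Q (x, h x) ≤ -c := by
  obtain ⟨H, hH0, hH⟩ := periodic_bdd hsm.continuous hper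
  have hlc : Continuous (fun x => ∑ i, pder i (pder i h) x) :=
    continuous_finsetSum _ fun i _ => (pder_contDiff i (pder_contDiff i hsm)).continuous
  obtain ⟨C, hC0, hC⟩ := periodic_bdd hlc (by
    intro x k
    exact Finset.sum_congr rfl fun i _ => pder_periodic i (pder_periodic i hper) x k)
  have hQ1 : Continuous (fun x => Q (x, Y1)) := hQ.continuous.comp (by fun_prop)
  obtain ⟨A, hA0, hA⟩ := periodic_bdd hQ1 (fun x k => hQp x Y1 k)
  have hQd : Differentiable ℝ Q := hQ.differentiable (by simp)
  set Y := min (Y1 - 2 * (A + 1)) (-H - 1) with hY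
  have hYle : Y ≤ Y1 - 2 * (A + 1) := min_le_left _ _
  have hYH : Y ≤ -H - 1 := min_le_right _ _
  have hQbot : ∀ x, 1 ≤ Q (x, Y) := by
    intro x
    have hder : ∀ t, HasDerivAt (fun t => Q (x, t) + t / 2) (DD none Q (x, t) + 1 / 2) t :=
      fun t => (hasDerivAt_vert x t (hQd _)).add ((hasDerivAt_id t).div_const 2)
    have hanti : AntitoneOn (fun t => Q (x, t) + t / 2) (Set.Iic Y1) := by
      refine antitoneOn_of_deriv_nonpos (convex_Iic _)
        (fun t _ => (hder t).continuousAt.continuousWithinAt)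
        (fun t _ => (hder t).differentiableAt.differentiableWithinAt) fun t ht => ?_
      rw [(hder t).deriv]
      have := hY1 x t (interior_subset (s := Set.Iic Y1) ht)
      linarith
    have := hanti (show Y ∈ Set.Iic Y1 by simp only [Set.mem_Iic]; linarith)
      (show Y1 ∈ Set.Iic Y1 by simp) (by linarith)
    simp only at this
    have h2 := abs_le.1 (hA x)
    linarith [h2.1]
  set α := C + 1 with hα
  have hα0 : 0 < α := by positivity
  set δ := Real.exp (-(α * (H - Y))) with hδ
  have hδ0 : 0 < δ := Real.exp_pos _
  set g : EuclideanSpace ℝ (Fin d) × ℝ → ℝ := fun q => Real.exp (α * (h q.1 - q.2)) with hg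
  have hgs : ContDiff ℝ (⊤ : ℕ∞) g := exp_shift_contDiff α hsm
  set f : EuclideanSpace ℝ (Fin d) × ℝ → ℝ := fun q => δ * g q - Q q with hf
  have hfs : ContDiff ℝ (⊤ : ℕ∞) f := (contDiff_const.mul hgs).sub hQ
  have hDf : ∀ a, DD a f = fun q => δ * DD a g q - DD a Q q := by
    intro a; funext q
    have h1 := hgs.differentiable (by simp) q
    rw [hf, DD_sub _ (h1.const_mul δ) (hQd q), DD_const_mul _ _ h1]
  have hDDf : ∀ a q, DD a (DD a f) q = δ * DD a (DD a g) q - DD a (DD a Q) q := by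
    intro a q
    have h1 := (DD_contDiff a hgs).differentiable (by simp) q
    have h2 := (DD_contDiff a hQ).differentiable (by simp) q
    rw [hDf, DD_sub _ (h1.const_mul δ) h2, DD_const_mul _ _ h1]
  have key := max_principle hsm.continuous hper hfs (by
      intro x y k
      simp only [hf, hg]
      rw [hper x k, hQp x y k]) Y δ (by
      intro p hp1 hp2
      simp only [hDDf]
      rw [Finset.sum_sub_distrib, hharm p hp2, ← Finset.mul_sum, hg, barrier_lap α hsm p, sub_zero]
      refine mul_pos hδ0 (mul_pos (Real.exp_pos _) ?_)
      have h1 := (abs_le.1 (hC p.1)).1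
      have h2 : 0 ≤ ∑ i, (pder i h p.1) ^ 2 := Finset.sum_nonneg fun i _ => sq_nonneg _
      have h3 : 0 ≤ α ^ 2 * ∑ i, (pder i h p.1) ^ 2 := by positivity
      have h4 : 0 < α * ((∑ i, pder i (pder i h) p.1) + α) := by
        apply mul_pos hα0; rw [hα]; linarith
      nlinarith) (by
      intro x
      have h1 := hQbot x
      have h2 : δ * g (x, Y) ≤ 1 := by
        rw [hδ, hg, ← Real.exp_add]
        apply Real.exp_le_one_iff.2
        have := (abs_le.1 (hH x)).2
        have : α * (h x - Y) ≤ α * (H - Y) := by gcongr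
        simp only
        linarith
      simp only [hf]
      linarith) (by
      intro x
      simp [hf, hg, hbd])
  refine ⟨δ * α, by positivity, fun x => ?_⟩
  have hd := hasDerivAt_vert x (h x) (hfs.differentiable (by simp) (x, h x))
  have hx : Y < h x := by
    have := (abs_le.1 (hH x)).1
    linarith
  have h0 := deriv_nonneg_of_left_max hx hd (by
    intro t ht1 ht2
    have h1 := key x t ht1 ht2
    have h2 : f (x, h x) = δ := by simp [hf, hg, hbd]
    rw [h2]; exact h1)
  rw [hDf] at h0
  simp only at h0
  rw [hg, barrier_none α hsm] at h0
  simp at h0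
  linarith

lemma vertical_bound {h : EuclideanSpace ℝ (Fin d) → ℝ}
    (hsm : ContDiff ℝ (⊤ : ℕ∞) h) (hper : ZPeriodic h)
    {Q : EuclideanSpace ℝ (Fin d) × ℝ → ℝ} (hQ : ContDiff ℝ (⊤ : ℕ∞) Q) (hQp : ZPeriodicX Q)
    (hharm : ∀ p : EuclideanSpace ℝ (Fin d) × ℝ, p.2 < h p.1 → ∑ a, DD a (DD a Q) p = 0)
    (hbd : ∀ x, Q (x, h x) = 0) (Y1 : ℝ) (hY1 : ∀ x y, y ≤ Y1 → DD none Q (x, y) ≤ -(1/2)) :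
    ∃ c > 0, ∀ x y, y ≤ h x → DD none Q (x, y) ≤ -c := by
  obtain ⟨c1, hc1, hb⟩ := boundary_bound hsm hper hQ hQp hharm hbd Y1 hY1
  obtain ⟨H, hH0, hH⟩ := periodic_bdd hsm.continuous hper
  set c0 := min c1 (1/2) with hc0
  have hc0p : 0 < c0 := by positivity
  have l1 : c0 ≤ c1 := min_le_left _ _
  have l2 : c0 ≤ 1/2 := min_le_right _ _
  set Y := min Y1 (-H) with hY
  have hYle : Y ≤ Y1 := min_le_left _ _
  have hYH : Y ≤ -H := min_le_right _ _
  set ε := c0 / 2 * Real.exp (-H) with hε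
  have hε0 : 0 < ε := by positivity
  have hεy : ∀ y, y ≤ H → ε * Real.exp y ≤ c0 / 2 := by
    intro y hy
    rw [hε, mul_assoc, ← Real.exp_add]
    have : Real.exp (-H + y) ≤ 1 := Real.exp_le_one_iff.2 (by linarith)
    nlinarith
  set g : EuclideanSpace ℝ (Fin d) × ℝ → ℝ := fun q => Real.exp ((-1) * ((0:ℝ) - q.2)) with hg
  have hz : ContDiff ℝ (⊤ : ℕ∞) (fun _ : EuclideanSpace ℝ (Fin d) => (0:ℝ)) := contDiff_const
  have hgs : ContDiff ℝ (⊤ : ℕ∞) g := exp_shift_contDiff (-1) hz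
  set u := DD none Q with hu
  have hus : ContDiff ℝ (⊤ : ℕ∞) u := DD_contDiff none hQ
  set f : EuclideanSpace ℝ (Fin d) × ℝ → ℝ := fun q => ε * g q + u q with hf
  have hfs : ContDiff ℝ (⊤ : ℕ∞) f := (contDiff_const.mul hgs).add hus
  have hDf : ∀ a, DD a f = fun q => ε * DD a g q + DD a u q := by
    intro a; funext q
    have h1 := hgs.differentiable (by simp) q
    rw [hf, DD_add _ (h1.const_mul ε) (hus.differentiable (by simp) q), DD_const_mul _ _ h1]
  have hDDf : ∀ a q, DD a (DD a f) q = ε * DD a (DD a g) q + DD a (DD a u) q := by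
    intro a q
    have h1 := (DD_contDiff a hgs).differentiable (by simp) q
    have h2 := (DD_contDiff a hus).differentiable (by simp) q
    rw [hDf, DD_add _ (h1.const_mul ε) h2, DD_const_mul _ _ h1]
  have hgy : ∀ x y, g (x, y) = Real.exp y := by intro x y; simp [hg]
  have key := max_principle hsm.continuous hper hfs (by
      intro x y k
      simp only [hf, hgy]
      rw [hu, DD_periodic none hQp x y k]) Y (-(c0/2)) (by
      intro p hp1 hp2
      simp only [hDDf]
      rw [Finset.sum_add_distrib, hu, lap_DD_zero none hQ hsm.continuous hharm p hp2,
        ← Finset.mul_sum, hg, barrier_lap (-1) hz p, add_zero]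
      refine mul_pos hε0 (mul_pos (Real.exp_pos _) ?_)
      have h2 : 0 ≤ ∑ i, (pder i (fun _ : EuclideanSpace ℝ (Fin d) => (0:ℝ)) p.1) ^ 2 :=
        Finset.sum_nonneg fun i _ => sq_nonneg _
      have h3 : ∀ i : Fin d, pder i (fun _ : EuclideanSpace ℝ (Fin d) => (0:ℝ)) = fun _ => 0 := by
        intro i; funext x; simp [pder]
      simp [h3]) (by
      intro x
      have h1 := hY1 x Y hYle
      have h2 := hεy Y (by linarith)
      simp only [hf, hgy]
      linarith) (by
      intro x
      have h1 := hb x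
      have h2 := hεy (h x) (abs_le.1 (hH x)).2
      simp only [hf, hgy]
      linarith)
  refine ⟨c0 / 2, by positivity, fun x y hy => ?_⟩
  rcases le_total Y y with h1 | h1
  · have := key x y h1 hy
    simp only [hf, hgy] at this
    have : 0 < ε * Real.exp y := by positivity
    linarith
  · have := hY1 x y (h1.trans hYle)
    linarith
end


lemma torus_div {d : ℕ} (V : Fin d → EuclideanSpace ℝ (Fin d) → ℝ)
    (hV : ∀ i, ContDiff ℝ (⊤ : ℕ∞) (V i)) (hp : ∀ i, ZPeriodic (V i)) :
    ∫ x in fundDom d, ∑ i, pder i (V i) x = 0 := by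
  rcases d with _ | n
  · simp
  set g : (Fin (n+1) → ℝ) → EuclideanSpace ℝ (Fin (n+1)) := WithLp.toLp 2 with hg
  have hmp : MeasurePreserving g := PiLp.volume_preserving_toLp _
  have hemb : MeasurableEmbedding g := (MeasurableEquiv.toLp 2 (Fin (n+1) → ℝ)).measurableEmbedding
  rw [← hmp.setIntegral_preimage_emb hemb]
  have hpre : g ⁻¹' (fundDom (n+1)) = Set.pi Set.univ fun i => Set.Ico ((0 : Fin (n+1) → ℝ) i) ((1 : Fin (n+1) → ℝ) i) := by
    ext x; simp [fundDom, hg]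
  have hae : (Set.pi Set.univ fun i => Set.Ico ((0 : Fin (n+1) → ℝ) i) ((1 : Fin (n+1) → ℝ) i))
      =ᵐ[volume] Set.Icc (0 : Fin (n+1) → ℝ) 1 :=
    Measure.univ_pi_Ico_ae_eq_Icc (μ := fun _ : Fin (n+1) => (volume : Measure ℝ))
  rw [hpre, setIntegral_congr_set hae]
  set L : (Fin (n+1) → ℝ) →L[ℝ] EuclideanSpace ℝ (Fin (n+1)) :=
    (PiLp.continuousLinearEquiv 2 ℝ (fun _ : Fin (n+1) => ℝ)).symm.toContinuousLinearMap with hL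
  have hLg : ∀ y, L y = g y := fun y => rfl
  have hgc : Continuous g := L.continuous
  have hc : Continuous (fun x => ∑ i, pder i (V i) (g x)) :=
    continuous_finsetSum _ fun i _ => (pder_contDiff i (hV i)).continuous.comp hgc
  have hsum : ∀ x, ∑ i, ((fderiv ℝ (V i) (g x)).comp L) (Pi.single i 1) = ∑ i, pder i (V i) (g x) := by
    intro x
    refine Finset.sum_congr rfl fun i _ => ?_
    rw [ContinuousLinearMap.comp_apply, hLg]; rfl
  have key := integral_divergence_of_hasFDerivAt_off_countable' (a := (0 : Fin (n+1) → ℝ)) (b := 1)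
    (by intro i; simp) (fun i x => V i (g x)) (fun i x => (fderiv ℝ (V i) (g x)).comp L) ∅
    (by simp) (fun i => ((hV i).continuous.comp hgc).continuousOn)
    (fun x _ i => by
      have h1 := ((hV i).differentiable (by simp) (g x)).hasFDerivAt
      exact HasFDerivAt.comp x h1 (L.hasFDerivAt (x := x)))
    (by
      simp only [hsum]
      exact hc.continuousOn.integrableOn_compact isCompact_Icc)
  simp only [hsum] at key
  rw [key]
  refine Finset.sum_eq_zero fun i _ => ?_
  rw [sub_eq_zero]
  refine integral_congr_ae (Filter.Eventually.of_forall fun x => ?_)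
  simp only
  symm
  rw [← hp i (g _) (Pi.single i 1)]
  congr 1
  ext j
  refine Fin.succAboveCases i ?_ ?_ j
  · simp [hg]
  · intro j; simp [hg]


section
variable {d : ℕ}

lemma fundDom_measurable (d : ℕ) : MeasurableSet (fundDom d) := by
  have : fundDom d = ⋂ i, {x : EuclideanSpace ℝ (Fin d) | 0 ≤ x i ∧ x i < 1} := by
    ext x; simp [fundDom]
  rw [this]
  refine MeasurableSet.iInter fun i => ?_
  have hm : Measurable (fun x : EuclideanSpace ℝ (Fin d) => x i) := by fun_prop
  exact (measurableSet_le measurable_const hm).inter (measurableSet_lt hm measurable_const)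

lemma fundDom_finite (d : ℕ) : volume (fundDom d) < ⊤ :=
  (measure_mono (fundDom_subset_cube d)).trans_lt (cube_compact d).measure_lt_top

noncomputable def divX (X : Option (Fin d) → EuclideanSpace ℝ (Fin d) × ℝ → ℝ)
    (p : EuclideanSpace ℝ (Fin d) × ℝ) : ℝ := ∑ a, DD a (X a) p

noncomputable def flux (h : EuclideanSpace ℝ (Fin d) → ℝ)
    (X : Option (Fin d) → EuclideanSpace ℝ (Fin d) × ℝ → ℝ) (x : EuclideanSpace ℝ (Fin d)) (s : ℝ) : ℝ :=
  X none (x, h x + s) - ∑ i, pder i h x * X (some i) (x, h x + s)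

lemma contOn_shear {h : EuclideanSpace ℝ (Fin d) → ℝ} (hh : Continuous h)
    {f : EuclideanSpace ℝ (Fin d) × ℝ → ℝ} (hf : ∀ x y, y ≤ h x → ContinuousAt f (x, y)) :
    ContinuousOn (fun p : EuclideanSpace ℝ (Fin d) × ℝ => f (p.1, h p.1 + p.2)) {p | p.2 ≤ 0} := by
  intro p hp
  have hc : ContinuousAt (fun p : EuclideanSpace ℝ (Fin d) × ℝ => (p.1, h p.1 + p.2)) p := by fun_prop
  exact (ContinuousAt.comp (f := fun p : EuclideanSpace ℝ (Fin d) × ℝ => (p.1, h p.1 + p.2))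
    (hf p.1 (h p.1 + p.2) (by simpa using hp)) hc).continuousWithinAt

lemma integrable_slab {f : EuclideanSpace ℝ (Fin d) × ℝ → ℝ} (n : ℝ)
    (hf : ContinuousOn f {p | p.2 ≤ 0}) :
    IntegrableOn f (fundDom d ×ˢ Set.Icc (-n) 0) := by
  have hK : IsCompact (cube d ×ˢ Set.Icc (-n) 0) := (cube_compact d).prod isCompact_Icc
  have : IntegrableOn f (cube d ×ˢ Set.Icc (-n) 0) :=
    (hf.mono (fun p hp => hp.2.2)).integrableOn_compact hK
  exact this.mono_set (Set.prod_mono (fundDom_subset_cube d) le_rfl)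

lemma slab_div {h : EuclideanSpace ℝ (Fin d) → ℝ}
    (hsm : ContDiff ℝ (⊤ : ℕ∞) h) (hper : ZPeriodic h)
    {X : Option (Fin d) → EuclideanSpace ℝ (Fin d) × ℝ → ℝ}
    (hX : ∀ a x y, y ≤ h x → ContDiffAt ℝ (⊤ : ℕ∞) (X a) (x, y))
    (hXp : ∀ a, ZPeriodicX (X a)) (n : ℝ) (hn : 0 ≤ n) :
    ∫ p in fundDom d ×ˢ Set.Icc (-n) 0, divX X (p.1, h p.1 + p.2)
      = ∫ x in fundDom d, (flux h X x 0 - flux h X x (-n)) := by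
  have hhd : Differentiable ℝ h := hsm.differentiable (by simp)
  have hhc := hsm.continuous
  have hpc : ∀ i, Continuous (pder i h) := fun i => (pder_contDiff i hsm).continuous
  have hXd : ∀ a x y, y ≤ h x → DifferentiableAt ℝ (X a) (x, y) :=
    fun a x y hy => (hX a x y hy).differentiableAt (by simp)
  have hDc : ∀ a b, ContinuousOn (fun p : EuclideanSpace ℝ (Fin d) × ℝ =>
      DD a (X b) (p.1, h p.1 + p.2)) {p | p.2 ≤ 0} := fun a b =>
    contOn_shear hhc fun x y hy => (DD_contDiffAt a (hX b x y hy)).continuousAt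
  have hpc' : ∀ i, ContinuousOn (fun p : EuclideanSpace ℝ (Fin d) × ℝ => pder i h p.1) {p | p.2 ≤ 0} :=
    fun i => ((hpc i).comp continuous_fst).continuousOn
  set A : EuclideanSpace ℝ (Fin d) × ℝ → ℝ := fun p =>
    ∑ i, (DD (some i) (X (some i)) (p.1, h p.1 + p.2)
      + pder i h p.1 * DD none (X (some i)) (p.1, h p.1 + p.2)) with hA
  set B : EuclideanSpace ℝ (Fin d) × ℝ → ℝ := fun p =>
    DD none (X none) (p.1, h p.1 + p.2)
      - ∑ i, pder i h p.1 * DD none (X (some i)) (p.1, h p.1 + p.2) with hB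
  have hAc : ContinuousOn A {p | p.2 ≤ 0} :=
    continuousOn_finsetSum _ fun i _ => (hDc _ _).add ((hpc' i).mul (hDc _ _))
  have hBc : ContinuousOn B {p | p.2 ≤ 0} :=
    (hDc _ _).sub (continuousOn_finsetSum _ fun i _ => (hpc' i).mul (hDc _ _))
  have hAB : ∀ p : EuclideanSpace ℝ (Fin d) × ℝ, divX X (p.1, h p.1 + p.2) = A p + B p := by
    intro p
    simp only [divX, hA, hB, Fintype.sum_option, Finset.sum_add_distrib]
    ring
  have hAi := integrable_slab n hAc
  have hBi := integrable_slab n hBc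
  simp only [hAB]
  rw [integral_add hAi hBi]
  have hA0 : ∫ p in fundDom d ×ˢ Set.Icc (-n) 0, A p = 0 := by
    rw [Measure.volume_eq_prod, ← Measure.prod_restrict]
    rw [Measure.volume_eq_prod, IntegrableOn, ← Measure.prod_restrict] at hAi
    rw [integral_prod_symm _ hAi]
    rw [setIntegral_congr_fun (g := fun _ => (0:ℝ)) measurableSet_Icc, integral_zero]
    intro s hs
    have hs0 : s ≤ 0 := hs.2
    have e : ∀ x, A (x, s) = ∑ i, pder i (fun x => X (some i) (x, h x + s)) x := by
      intro x
      refine Finset.sum_congr rfl fun i _ => ?_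
      rw [pder_comp_graph i hhd s x (hXd _ _ _ (by linarith))]
    simp only [e]
    refine torus_div _ (fun i => ?_) (fun i => ?_)
    · refine contDiff_iff_contDiffAt.2 fun x => ?_
      refine ContDiffAt.comp (f := fun x => (x, h x + s)) x (hX (some i) x (h x + s) (by linarith)) ?_
      exact contDiffAt_id.prodMk (hsm.contDiffAt.add contDiffAt_const)
    · intro x k
      simp only
      rw [hper x k, hXp (some i) x _ k]
  rw [hA0, zero_add]
  rw [Measure.volume_eq_prod] at hBi ⊢
  rw [setIntegral_prod _ hBi]
  refine setIntegral_congr_fun (fundDom_measurable d) fun x _ => ?_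
  rw [integral_Icc_eq_integral_Ioc, ← intervalIntegral.integral_of_le (by linarith)]
  refine intervalIntegral.integral_eq_sub_of_hasDerivAt (f := flux h X x) ?_ ?_
  · intro s hs
    rw [Set.uIcc_of_le (by linarith)] at hs
    have key : ∀ a, HasDerivAt (fun s => X a (x, h x + s)) (DD none (X a) (x, h x + s)) s := by
      intro a
      exact (hasDerivAt_vert x (h x + s) (hXd a x (h x + s) (by linarith [hs.2]))).comp_const_add (h x) s
    unfold flux
    exact (key none).sub (HasDerivAt.fun_sum fun i _ => (key (some i)).const_mul _)
  · refine ContinuousOn.intervalIntegrable ?_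
    rw [Set.uIcc_of_le (by linarith)]
    exact hBc.comp (f := fun s : ℝ => (x, s)) (by fun_prop) fun s hs => hs.2

lemma shear_mp {h : EuclideanSpace ℝ (Fin d) → ℝ} (hh : Continuous h) :
    MeasurePreserving (fun p : EuclideanSpace ℝ (Fin d) × ℝ => (p.1, h p.1 + p.2)) := by
  refine MeasurePreserving.skew_product (MeasurePreserving.id _) (g := fun x s => h x + s)
    (by simp only [Function.uncurry_def]; fun_prop) ?_
  exact Filter.Eventually.of_forall fun x => map_add_left_eq_self _ _

lemma shear_emb {h : EuclideanSpace ℝ (Fin d) → ℝ} (hh : Continuous h) :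
    MeasurableEmbedding (fun p : EuclideanSpace ℝ (Fin d) × ℝ => (p.1, h p.1 + p.2)) := by
  have hc : Continuous (fun p : EuclideanSpace ℝ (Fin d) × ℝ => (p.1, h p.1 + p.2)) := by fun_prop
  refine hc.measurableEmbedding ?_
  rintro ⟨x, s⟩ ⟨x', s'⟩ e
  simp only [Prod.mk.injEq] at e
  obtain ⟨rfl, e⟩ := e
  simpa using e

lemma full_div {h : EuclideanSpace ℝ (Fin d) → ℝ}
    (hsm : ContDiff ℝ (⊤ : ℕ∞) h) (hper : ZPeriodic h)
    {X : Option (Fin d) → EuclideanSpace ℝ (Fin d) × ℝ → ℝ}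
    (hX : ∀ a x y, y ≤ h x → ContDiffAt ℝ (⊤ : ℕ∞) (X a) (x, y))
    (hXp : ∀ a, ZPeriodicX (X a))
    (hnn : ∀ x y, y ≤ h x → 0 ≤ divX X (x, y))
    (hdec : ∀ ε > 0, ∃ S : ℝ, ∀ s ≤ S, ∀ x, |flux h X x s| ≤ ε) :
    ∫ p in {p : EuclideanSpace ℝ (Fin d) × ℝ | p.1 ∈ fundDom d ∧ p.2 < h p.1}, divX X p
      = ∫ x in fundDom d, flux h X x 0 := by
  have hhc := hsm.continuous
  rw [← (shear_mp hhc).setIntegral_preimage_emb (shear_emb hhc)]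
  have hpre : (fun p : EuclideanSpace ℝ (Fin d) × ℝ => (p.1, h p.1 + p.2)) ⁻¹'
      {p : EuclideanSpace ℝ (Fin d) × ℝ | p.1 ∈ fundDom d ∧ p.2 < h p.1} = fundDom d ×ˢ Set.Iio 0 := by
    ext p; simp
  rw [hpre]
  have hae : fundDom d ×ˢ Set.Iio (0:ℝ) =ᵐ[volume] fundDom d ×ˢ Set.Iic (0:ℝ) :=
    Measure.set_prod_ae_eq (Filter.EventuallyEq.refl _ _) Iio_ae_eq_Iic
  rw [setIntegral_congr_set hae]
  have hFc : ∀ s ≤ 0, Continuous (fun x => flux h X x s) := by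
    intro s hs
    have key : ∀ a, Continuous (fun x => X a (x, h x + s)) := by
      intro a
      refine continuous_iff_continuousAt.2 fun x => ?_
      exact ContinuousAt.comp (f := fun x => (x, h x + s))
        (hX a x (h x + s) (by linarith)).continuousAt (by fun_prop)
    exact (key none).sub (continuous_finsetSum _ fun i _ =>
      (pder_contDiff i hsm).continuous.mul (key (some i)))
  have hFi : ∀ s ≤ 0, IntegrableOn (fun x => flux h X x s) (fundDom d) := fun s hs =>
    ((hFc s hs).continuousOn.integrableOn_compact (cube_compact d)).mono_set (fundDom_subset_cube d)
  have hcover : AECover (volume.restrict (fundDom d ×ˢ Set.Iic (0:ℝ))) Filter.atTop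
      (fun n : ℕ => {p : EuclideanSpace ℝ (Fin d) × ℝ | -(n:ℝ) ≤ p.2}) := by
    refine ⟨Filter.Eventually.of_forall fun p => ?_, fun n => measurableSet_le measurable_const measurable_snd⟩
    obtain ⟨N, hN⟩ := exists_nat_ge (-p.2)
    filter_upwards [Filter.eventually_ge_atTop N] with n hn
    have : (N:ℝ) ≤ n := by exact_mod_cast hn
    show -(n:ℝ) ≤ p.2
    linarith
  have hrest : ∀ n : ℕ, (volume.restrict (fundDom d ×ˢ Set.Iic (0:ℝ))).restrict
      {p : EuclideanSpace ℝ (Fin d) × ℝ | -(n:ℝ) ≤ p.2} = volume.restrict (fundDom d ×ˢ Set.Icc (-(n:ℝ)) 0) := by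
    intro n
    rw [Measure.restrict_restrict (measurableSet_le measurable_const measurable_snd)]
    congr 1
    ext p
    simp only [Set.mem_inter_iff, Set.mem_ofPred_eq, Set.mem_prod, Set.mem_Iic, Set.mem_Icc]
    tauto
  refine hcover.integral_eq_of_tendsto_of_nonneg_ae _ ?_ ?_ ?_
  · rw [Filter.EventuallyLE, ae_restrict_iff' ((fundDom_measurable d).prod measurableSet_Iic)]
    refine Filter.Eventually.of_forall fun p hp => hnn _ _ ?_
    have : p.2 ≤ 0 := hp.2
    linarith
  · intro n
    rw [IntegrableOn, hrest]
    refine integrable_slab _ (contOn_shear hhc fun x y hy => ?_)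
    unfold divX
    exact tendsto_finsetSum _ fun a _ => (DD_contDiffAt a (hX a x y hy)).continuousAt
  · have e : ∀ n : ℕ, ∫ p in {p : EuclideanSpace ℝ (Fin d) × ℝ | -(n:ℝ) ≤ p.2},
        divX X (p.1, h p.1 + p.2) ∂(volume.restrict (fundDom d ×ˢ Set.Iic (0:ℝ)))
        = (∫ x in fundDom d, flux h X x 0) - ∫ x in fundDom d, flux h X x (-(n:ℝ)) := by
      intro n
      rw [hrest, slab_div hsm hper hX hXp n (by positivity),
        integral_sub (hFi 0 le_rfl) (hFi _ (by simp))]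
    simp only [e]
    conv => rhs; rw [← sub_zero (∫ x in fundDom d, flux h X x 0)]
    refine tendsto_const_nhds.sub ?_
    rw [Metric.tendsto_atTop]
    intro ε hε
    set v := volume.real (fundDom d) with hv
    have hv0 : 0 ≤ v := measureReal_nonneg
    obtain ⟨S, hS⟩ := hdec (ε / (2 * (v + 1))) (by positivity)
    obtain ⟨N, hN⟩ := exists_nat_ge (-S)
    refine ⟨N, fun n hn => ?_⟩
    have : (N:ℝ) ≤ n := by exact_mod_cast hn
    rw [dist_zero_right]
    have hb := norm_setIntegral_le_of_norm_le_const (μ := volume) (s := fundDom d)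
      (f := fun x => flux h X x (-(n:ℝ))) (C := ε / (2 * (v + 1))) (fundDom_finite d)
      (fun x _ => hS _ (by linarith) x)
    refine hb.trans_lt ?_
    rw [← hv, div_mul_eq_mul_div, div_lt_iff₀ (by positivity)]
    nlinarith
end


section
variable {d : ℕ}

lemma zero_ext {h : EuclideanSpace ℝ (Fin d) → ℝ} {g : EuclideanSpace ℝ (Fin d) × ℝ → ℝ}
    (hg : Continuous g) (h0 : ∀ p : EuclideanSpace ℝ (Fin d) × ℝ, p.2 < h p.1 → g p = 0)
    (x : EuclideanSpace ℝ (Fin d)) (y : ℝ) (hy : y ≤ h x) : g (x, y) = 0 := by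
  have hc : Continuous (fun t : ℝ => g (x, t)) := hg.comp (by fun_prop)
  have hcl : IsClosed {t : ℝ | g (x, t) = 0} := isClosed_eq hc continuous_const
  have hsub : Set.Iio (h x) ⊆ {t : ℝ | g (x, t) = 0} := fun t ht => h0 (x, t) ht
  have := closure_minimal hsub hcl
  rw [closure_Iio] at this
  exact this hy

noncomputable def NN (Q : EuclideanSpace ℝ (Fin d) × ℝ → ℝ) (a : Option (Fin d))
    (p : EuclideanSpace ℝ (Fin d) × ℝ) : ℝ := ∑ b, DD b Q p * DD a (DD b Q) p

noncomputable def GG (Q : EuclideanSpace ℝ (Fin d) × ℝ → ℝ)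
    (p : EuclideanSpace ℝ (Fin d) × ℝ) : ℝ := ∑ b, (DD b Q p) ^ 2

noncomputable def XX (Q : EuclideanSpace ℝ (Fin d) × ℝ → ℝ) (a : Option (Fin d))
    (p : EuclideanSpace ℝ (Fin d) × ℝ) : ℝ := NN Q a p / Real.sqrt (GG Q p)

lemma NN_contDiff {Q : EuclideanSpace ℝ (Fin d) × ℝ → ℝ} (hQ : ContDiff ℝ (⊤ : ℕ∞) Q)
    (a : Option (Fin d)) : ContDiff ℝ (⊤ : ℕ∞) (NN Q a) :=
  ContDiff.sum fun b _ => (DD_contDiff b hQ).mul (DD_contDiff a (DD_contDiff b hQ))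

lemma GG_contDiff {Q : EuclideanSpace ℝ (Fin d) × ℝ → ℝ} (hQ : ContDiff ℝ (⊤ : ℕ∞) Q) :
    ContDiff ℝ (⊤ : ℕ∞) (GG Q) :=
  ContDiff.sum fun b _ => (DD_contDiff b hQ).pow 2

lemma GG_nonneg (Q : EuclideanSpace ℝ (Fin d) × ℝ → ℝ) (p : EuclideanSpace ℝ (Fin d) × ℝ) :
    0 ≤ GG Q p := Finset.sum_nonneg fun _ _ => sq_nonneg _

lemma sqrtG_contDiffAt {Q : EuclideanSpace ℝ (Fin d) × ℝ → ℝ} (hQ : ContDiff ℝ (⊤ : ℕ∞) Q)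
    {p : EuclideanSpace ℝ (Fin d) × ℝ} (hp : GG Q p ≠ 0) :
    ContDiffAt ℝ (⊤ : ℕ∞) (fun q => Real.sqrt (GG Q q)) p :=
  (GG_contDiff hQ).contDiffAt.sqrt hp

lemma XX_contDiffAt {Q : EuclideanSpace ℝ (Fin d) × ℝ → ℝ} (hQ : ContDiff ℝ (⊤ : ℕ∞) Q)
    (a : Option (Fin d)) {p : EuclideanSpace ℝ (Fin d) × ℝ} (hp : GG Q p ≠ 0) :
    ContDiffAt ℝ (⊤ : ℕ∞) (XX Q a) p :=
  (NN_contDiff hQ a).contDiffAt.div (sqrtG_contDiffAt hQ hp)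
    (Real.sqrt_ne_zero'.2 (lt_of_le_of_ne (GG_nonneg Q p) hp.symm))

lemma XX_periodic {Q : EuclideanSpace ℝ (Fin d) × ℝ → ℝ} (hQ : ZPeriodicX Q)
    (a : Option (Fin d)) : ZPeriodicX (XX Q a) := by
  intro x y k
  simp only [XX, NN, GG]
  simp only [DD_periodic _ hQ x y k, DD_periodic _ (DD_periodic _ hQ) x y k]

lemma DD_NN {Q : EuclideanSpace ℝ (Fin d) × ℝ → ℝ} (hQ : ContDiff ℝ (⊤ : ℕ∞) Q)
    (a : Option (Fin d)) (p : EuclideanSpace ℝ (Fin d) × ℝ) :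
    DD a (NN Q a) p = ∑ b, (DD a (DD b Q) p) ^ 2 + ∑ b, DD b Q p * DD a (DD a (DD b Q)) p := by
  have h1 : ∀ b, DifferentiableAt ℝ (DD b Q) p := fun b => (DD_contDiff b hQ).differentiable (by simp) p
  have h2 : ∀ b, DifferentiableAt ℝ (DD a (DD b Q)) p :=
    fun b => (DD_contDiff a (DD_contDiff b hQ)).differentiable (by simp) p
  have : NN Q a = fun q => ∑ b, DD b Q q * DD a (DD b Q) q := rfl
  rw [this, DD_sum _ _ (fun b => (h1 b).fun_mul (h2 b)), ← Finset.sum_add_distrib]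
  refine Finset.sum_congr rfl fun b _ => ?_
  rw [DD_mul _ (h1 b) (h2 b)]; ring

lemma DD_GG {Q : EuclideanSpace ℝ (Fin d) × ℝ → ℝ} (hQ : ContDiff ℝ (⊤ : ℕ∞) Q)
    (a : Option (Fin d)) (p : EuclideanSpace ℝ (Fin d) × ℝ) :
    DD a (GG Q) p = 2 * NN Q a p := by
  have h1 : ∀ b, DifferentiableAt ℝ (DD b Q) p := fun b => (DD_contDiff b hQ).differentiable (by simp) p
  have : GG Q = fun q => ∑ b, DD b Q q * DD b Q q := by
    funext q; simp only [GG, sq]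
  rw [this, DD_sum _ _ (fun b => (h1 b).fun_mul (h1 b)), NN, Finset.mul_sum]
  refine Finset.sum_congr rfl fun b _ => ?_
  rw [DD_mul _ (h1 b) (h1 b)]; ring

lemma divX_XX {Q : EuclideanSpace ℝ (Fin d) × ℝ → ℝ} (hQ : ContDiff ℝ (⊤ : ℕ∞) Q)
    {p : EuclideanSpace ℝ (Fin d) × ℝ} (hp : GG Q p ≠ 0)
    (hl : ∀ b, ∑ a, DD a (DD a (DD b Q)) p = 0) :
    divX (XX Q) p = (fullGradSq Q p * fullHessSq Q p - gradDotHessSq Q p)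
      / Real.sqrt (fullGradSq Q p) ^ 3 := by
  have hG : fullGradSq Q p = GG Q p := fullGradSq_eq Q p
  have hD : gradDotHessSq Q p = ∑ a, (NN Q a p) ^ 2 := gradDotHessSq_eq Q p
  rw [hG, hD, fullHessSq_eq]
  have hpos : 0 < GG Q p := lt_of_le_of_ne (GG_nonneg Q p) hp.symm
  set R : EuclideanSpace ℝ (Fin d) × ℝ → ℝ := fun q => Real.sqrt (GG Q q) with hR
  have hRd : DifferentiableAt ℝ R p := (sqrtG_contDiffAt hQ hp).differentiableAt (by simp)
  have hRp : 0 < R p := Real.sqrt_pos.2 hpos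
  have hRR : R p * R p = GG Q p := Real.mul_self_sqrt hpos.le
  have hDR : ∀ a, R p * DD a R p = NN Q a p := by
    intro a
    have e : (fun q => R q * R q) = GG Q := funext fun q => Real.mul_self_sqrt (GG_nonneg Q q)
    have := DD_mul a hRd hRd
    rw [e, DD_GG hQ] at this
    linarith
  have hDX : ∀ a, DD a (XX Q a) p = DD a (NN Q a) p / R p - (NN Q a p) ^ 2 / (R p) ^ 3 := by
    intro a
    have hev : (fun q => R q * XX Q a q) =ᶠ[nhds p] NN Q a := by
      have : ∀ᶠ q in nhds p, GG Q q ≠ 0 :=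
        (GG_contDiff hQ).continuous.continuousAt.eventually_ne hp
      filter_upwards [this] with q hq
      have : R q ≠ 0 := Real.sqrt_ne_zero'.2 (lt_of_le_of_ne (GG_nonneg Q q) hq.symm)
      show R q * (NN Q a q / R q) = NN Q a q
      field_simp
    have h1 := DD_mul a hRd ((XX_contDiffAt hQ a hp).differentiableAt (by simp))
    rw [DD_congr a hev] at h1
    have h2 : DD a R p = NN Q a p / R p := by
      rw [← hDR a]; field_simp
    have h3 : XX Q a p = NN Q a p / R p := rfl
    rw [h2, h3] at h1
    rw [h1]; field_simp; ring
  have hs : ∑ a, DD a (NN Q a) p = ∑ a, ∑ b, (DD a (DD b Q) p) ^ 2 := by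
    simp only [DD_NN hQ]
    rw [Finset.sum_add_distrib, Finset.sum_comm (f := fun a b => DD b Q p * DD a (DD a (DD b Q)) p)]
    simp only [← Finset.mul_sum, hl]
    simp
  unfold divX
  simp only [hDX]
  rw [Finset.sum_sub_distrib, ← Finset.sum_div, ← Finset.sum_div, hs, ← hRR]
  rw [Real.sqrt_mul_self hRp.le]
  field_simp

lemma integrand_nonneg (Q : EuclideanSpace ℝ (Fin d) × ℝ → ℝ) (p : EuclideanSpace ℝ (Fin d) × ℝ) :
    0 ≤ (fullGradSq Q p * fullHessSq Q p - gradDotHessSq Q p)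
      / Real.sqrt (fullGradSq Q p) ^ 3 := by
  refine div_nonneg ?_ (by positivity)
  rw [sub_nonneg, fullGradSq_eq, fullHessSq_eq, gradDotHessSq_eq, Finset.mul_sum]
  refine Finset.sum_le_sum fun a _ => ?_
  exact Finset.sum_mul_sq_le_sq_mul_sq _ _ _

lemma XX_le (Q : EuclideanSpace ℝ (Fin d) × ℝ → ℝ) (a : Option (Fin d))
    (p : EuclideanSpace ℝ (Fin d) × ℝ) : |XX Q a p| ≤ ∑ b, |DD a (DD b Q) p| := by
  have h0 : 0 ≤ Real.sqrt (GG Q p) := Real.sqrt_nonneg _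
  rw [XX, abs_div, abs_of_nonneg h0]
  refine div_le_of_le_mul₀ h0 (Finset.sum_nonneg fun _ _ => abs_nonneg _) ?_
  refine (Finset.abs_sum_le_sum_abs _ _).trans ?_
  rw [Finset.sum_mul]
  refine Finset.sum_le_sum fun b _ => ?_
  rw [abs_mul, mul_comm]
  refine mul_le_mul_of_nonneg_left ?_ (abs_nonneg _)
  refine Real.abs_le_sqrt ?_
  exact Finset.single_le_sum (f := fun b => (DD b Q p) ^ 2) (fun _ _ => sq_nonneg _) (Finset.mem_univ b)

lemma flux_alg (g : Fin d → ℝ) (H : Fin d → Fin d → ℝ) (M : Option (Fin d) → Option (Fin d) → ℝ)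
    (q r : ℝ) (hq : q ≠ 0) (hr : 0 < r) (hr2 : r ^ 2 = 1 + ∑ i, g i ^ 2)
    (hsym : ∀ a b, M a b = M b a) (htr : ∑ a, M a a = 0)
    (hrel : ∀ i j, M (some i) (some j) + g i * M none (some j) + (H i j * q +
      g j * (M (some i) none + g i * M none none)) = 0) :
    (-(∑ i, (H i i / r - g i * (∑ j, g j * H i j) / r ^ 3))) * (q * r ^ 2)
      = (q * M none none + ∑ j, (-(g j * q)) * M none (some j)) / (-q * r)
        - ∑ i, g i * ((q * M (some i) none + ∑ j, (-(g j * q)) * M (some i) (some j)) / (-q * r)) := by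
  set A := ∑ i, ∑ j, g i * g j * M (some i) (some j) with hA
  set B := ∑ i, g i * M (some i) none with hB
  set Y := M none none with hY
  set m := ∑ i, g i ^ 2 with hm
  set T := ∑ i, H i i with hT
  set U := ∑ i, ∑ j, g i * g j * H i j with hU
  have htr' : ∑ i, M (some i) (some i) = -Y := by
    rw [Fintype.sum_option] at htr; linarith
  have hqT : q * T = Y - 2 * B - Y * m := by
    have : ∑ i, (M (some i) (some i) + g i * M none (some i) + (H i i * q +
      g i * (M (some i) none + g i * M none none))) = 0 := Finset.sum_eq_zero fun i _ => hrel i i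
    have e : ∀ i, M (some i) (some i) + g i * M none (some i) + (H i i * q +
      g i * (M (some i) none + g i * M none none)) = M (some i) (some i) + 2 * (g i * M (some i) none)
        + q * H i i + Y * g i ^ 2 := by
      intro i; rw [hsym none (some i)]; ring
    simp only [e] at this
    rw [Finset.sum_add_distrib, Finset.sum_add_distrib, Finset.sum_add_distrib, ← Finset.mul_sum,
      ← Finset.mul_sum, ← Finset.mul_sum, htr'] at this
    linarith
  have hqU : q * U = -(A + 2 * B * m + Y * m ^ 2) := by
    have : ∑ i, ∑ j, g i * g j * (M (some i) (some j) + g i * M none (some j) + (H i j * q +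
      g j * (M (some i) none + g i * M none none))) = 0 :=
      Finset.sum_eq_zero fun i _ => Finset.sum_eq_zero fun j _ => by rw [hrel i j, mul_zero]
    have e : ∀ i j, g i * g j * (M (some i) (some j) + g i * M none (some j) + (H i j * q +
      g j * (M (some i) none + g i * M none none))) = g i * g j * M (some i) (some j)
        + g i ^ 2 * (g j * M (some j) none) + q * (g i * g j * H i j)
        + (g i * M (some i) none) * g j ^ 2 + Y * (g i ^ 2 * g j ^ 2) := by
      intro i j; rw [hsym none (some j)]; ring
    simp only [e, Finset.sum_add_distrib, ← Finset.mul_sum, ← Finset.sum_mul] at this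
    simp only [← hB, ← hm] at this
    rw [← hA, ← hU] at this
    linarith
  have hL : (-(∑ i, (H i i / r - g i * (∑ j, g j * H i j) / r ^ 3))) = -(T / r - U / r ^ 3) := by
    rw [Finset.sum_sub_distrib, ← Finset.sum_div, ← Finset.sum_div, hT, hU]
    simp only [Finset.mul_sum, mul_assoc]
  have hR1 : (q * M none none + ∑ j, (-(g j * q)) * M none (some j)) / (-q * r) = -(Y - B) / r := by
    have : ∑ j, (-(g j * q)) * M none (some j) = - q * B := by
      rw [hB, Finset.mul_sum]
      refine Finset.sum_congr rfl fun j _ => ?_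
      rw [hsym none (some j)]; ring
    rw [this]; field_simp; ring
  have hR2 : ∑ i, g i * ((q * M (some i) none + ∑ j, (-(g j * q)) * M (some i) (some j)) / (-q * r))
      = -(B - A) / r := by
    have : ∀ i, g i * ((q * M (some i) none + ∑ j, (-(g j * q)) * M (some i) (some j)) / (-q * r))
      = (-1 / r) * (g i * M (some i) none - ∑ j, g i * g j * M (some i) (some j)) := by
      intro i
      have : ∑ j, (-(g j * q)) * M (some i) (some j) = -q * ∑ j, g j * M (some i) (some j) := by
        rw [Finset.mul_sum]
        refine Finset.sum_congr rfl fun j _ => by ring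
      rw [this]
      simp only [mul_assoc (g i), ← Finset.mul_sum]
      field_simp; ring
    simp only [this]
    rw [← Finset.mul_sum, Finset.sum_sub_distrib]
    show -1 / r * (B - A) = _
    field_simp
  rw [hL, hR1, hR2]
  have e1 : -(T / r - U / r ^ 3) * (q * r ^ 2) = (-(q * T) * r ^ 2 + q * U) / r := by
    field_simp; ring
  rw [e1, hqT, hqU, hr2]
  field_simp; ring

lemma pder_mul (i : Fin d) {f g : EuclideanSpace ℝ (Fin d) → ℝ}
    {p : EuclideanSpace ℝ (Fin d)} (hf : DifferentiableAt ℝ f p) (hg : DifferentiableAt ℝ g p) :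
    pder i (fun q => f q * g q) p = f p * pder i g p + g p * pder i f p := by
  unfold pder; rw [fderiv_fun_mul hf hg]; simp

lemma pder_add (i : Fin d) {f g : EuclideanSpace ℝ (Fin d) → ℝ}
    {p : EuclideanSpace ℝ (Fin d)} (hf : DifferentiableAt ℝ f p) (hg : DifferentiableAt ℝ g p) :
    pder i (fun q => f q + g q) p = pder i f p + pder i g p := by
  unfold pder; rw [fderiv_fun_add hf hg]; simp

lemma pder_const (i : Fin d) (c : ℝ) (p : EuclideanSpace ℝ (Fin d)) :
    pder i (fun _ => c) p = 0 := by
  unfold pder; simp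

lemma pder_sum {ι : Type*} (s : Finset ι) (i : Fin d) {f : ι → EuclideanSpace ℝ (Fin d) → ℝ}
    {p : EuclideanSpace ℝ (Fin d)} (hf : ∀ i, DifferentiableAt ℝ (f i) p) :
    pder i (fun q => ∑ j ∈ s, f j q) p = ∑ j ∈ s, pder i (f j) p := by
  unfold pder; rw [fderiv_fun_sum fun i _ => hf i]; simp

noncomputable def rr (h : EuclideanSpace ℝ (Fin d) → ℝ) (x : EuclideanSpace ℝ (Fin d)) : ℝ :=
  Real.sqrt (1 + ∑ j, (pder j h x) ^ 2)

lemma rr_arg_pos (h : EuclideanSpace ℝ (Fin d) → ℝ) (x : EuclideanSpace ℝ (Fin d)) :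
    0 < 1 + ∑ j, (pder j h x) ^ 2 := by
  have : 0 ≤ ∑ j, (pder j h x) ^ 2 := Finset.sum_nonneg fun _ _ => sq_nonneg _
  linarith

lemma rr_pos (h : EuclideanSpace ℝ (Fin d) → ℝ) (x : EuclideanSpace ℝ (Fin d)) :
    0 < rr h x := Real.sqrt_pos.2 (rr_arg_pos h x)

lemma rr_contDiff {h : EuclideanSpace ℝ (Fin d) → ℝ} (hsm : ContDiff ℝ (⊤ : ℕ∞) h) :
    ContDiff ℝ (⊤ : ℕ∞) (rr h) :=
  (contDiff_const.add (ContDiff.sum fun j _ => (pder_contDiff j hsm).pow 2)).sqrt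
    fun x => (rr_arg_pos h x).ne'

lemma slope_contDiff {h : EuclideanSpace ℝ (Fin d) → ℝ} (hsm : ContDiff ℝ (⊤ : ℕ∞) h) (i : Fin d) :
    ContDiff ℝ (⊤ : ℕ∞) (fun y => pder i h y / rr h y) :=
  (pder_contDiff i hsm).div (rr_contDiff hsm) fun x => (rr_pos h x).ne'

lemma curvature_eq {h : EuclideanSpace ℝ (Fin d) → ℝ} (hsm : ContDiff ℝ (⊤ : ℕ∞) h)
    (x : EuclideanSpace ℝ (Fin d)) :
    curvature h x = -(∑ i, (pder i (pder i h) x / rr h x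
      - pder i h x * (∑ j, pder j h x * pder i (pder j h) x) / rr h x ^ 3)) := by
  have hp := rr_pos h x
  have hpd : ∀ i, DifferentiableAt ℝ (pder i h) x := fun i => (pder_contDiff i hsm).differentiable (by simp) x
  have hrd : DifferentiableAt ℝ (rr h) x := (rr_contDiff hsm).differentiable (by simp) x
  unfold curvature
  congr 1
  refine Finset.sum_congr rfl fun i _ => ?_
  show pder i (fun y => pder i h y / rr h y) x = _
  have h1 : rr h x * pder i (rr h) x = ∑ j, pder j h x * pder i (pder j h) x := by
    have e : (fun y => rr h y * rr h y) = fun y => 1 + ∑ j, pder j h y * pder j h y := by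
      funext y
      have := Real.mul_self_sqrt (rr_arg_pos h y).le
      simp only [rr]; rw [this]; simp only [sq]
    have := pder_mul i hrd hrd
    rw [e, pder_add i (differentiableAt_const _) (DifferentiableAt.fun_sum fun j _ => (hpd j).fun_mul (hpd j)),
      pder_const, pder_sum _ _ (fun j => (hpd j).fun_mul (hpd j))] at this
    have e2 : ∀ j, pder i (fun q => pder j h q * pder j h q) x = 2 * (pder j h x * pder i (pder j h) x) := by
      intro j; rw [pder_mul i (hpd j) (hpd j)]; ring
    simp only [e2, ← Finset.mul_sum] at this
    linarith
  have h2 := pder_mul i hrd ((slope_contDiff hsm i).differentiable (by simp) x)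
  have e : (fun y => rr h y * (pder i h y / rr h y)) = pder i h := by
    funext y
    have := (rr_pos h y).ne'
    field_simp
  rw [e] at h2
  rw [← h1, h2]
  field_simp; ring

lemma curvature_integral {h : EuclideanSpace ℝ (Fin d) → ℝ} (hsm : ContDiff ℝ (⊤ : ℕ∞) h)
    (hper : ZPeriodic h) : ∫ x in fundDom d, curvature h x = 0 := by
  have := torus_div (fun i y => pder i h y / rr h y) (fun i => slope_contDiff hsm i) (by
    intro i x k
    simp only [rr, pder_periodic _ hper x k])
  unfold curvature
  rw [integral_neg]
  simpa [rr] using this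

lemma curvature_continuous {h : EuclideanSpace ℝ (Fin d) → ℝ} (hsm : ContDiff ℝ (⊤ : ℕ∞) h) :
    Continuous (curvature h) := by
  have : curvature h = fun x => -(∑ i, pder i (fun y => pder i h y / rr h y) x) := rfl
  rw [this]
  exact (continuous_finsetSum _ fun i _ => (pder_contDiff i (slope_contDiff hsm i)).continuous).neg

/-- boundary identities -/
lemma boundary_tangent {h : EuclideanSpace ℝ (Fin d) → ℝ} (hsm : ContDiff ℝ (⊤ : ℕ∞) h)
    {Q : EuclideanSpace ℝ (Fin d) × ℝ → ℝ} (hQ : ContDiff ℝ (⊤ : ℕ∞) Q)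
    (hbd : ∀ x, Q (x, h x) = 0) (j : Fin d) (x : EuclideanSpace ℝ (Fin d)) :
    DD (some j) Q (x, h x) + pder j h x * DD none Q (x, h x) = 0 := by
  have := pder_comp_graph j (hsm.differentiable (by simp)) 0 x (hQ.differentiable (by simp) (x, h x + 0))
  simp only [add_zero, hbd, pder_const] at this
  exact this.symm

lemma pder_comp_graph0 (i : Fin d) {f : EuclideanSpace ℝ (Fin d) × ℝ → ℝ}
    {h : EuclideanSpace ℝ (Fin d) → ℝ} (hh : Differentiable ℝ h)
    (x : EuclideanSpace ℝ (Fin d)) (hf : DifferentiableAt ℝ f (x, h x)) :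
    pder i (fun x => f (x, h x)) x
      = DD (some i) f (x, h x) + pder i h x * DD none f (x, h x) := by
  have := pder_comp_graph i hh 0 x (by simpa using hf)
  simpa only [add_zero] using this

lemma boundary_second {h : EuclideanSpace ℝ (Fin d) → ℝ} (hsm : ContDiff ℝ (⊤ : ℕ∞) h)
    {Q : EuclideanSpace ℝ (Fin d) × ℝ → ℝ} (hQ : ContDiff ℝ (⊤ : ℕ∞) Q)
    (hbd : ∀ x, Q (x, h x) = 0) (i j : Fin d) (x : EuclideanSpace ℝ (Fin d)) :
    DD (some i) (DD (some j) Q) (x, h x) + pder i h x * DD none (DD (some j) Q) (x, h x)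
      + (pder i (pder j h) x * DD none Q (x, h x) + pder j h x *
        (DD (some i) (DD none Q) (x, h x) + pder i h x * DD none (DD none Q) (x, h x))) = 0 := by
  have hhd : Differentiable ℝ h := hsm.differentiable (by simp)
  have h0 : (fun x => DD (some j) Q (x, h x) + pder j h x * DD none Q (x, h x)) = fun _ => 0 :=
    funext fun x => boundary_tangent hsm hQ hbd j x
  have hd : ∀ a, Differentiable ℝ (DD a Q) := fun a => (DD_contDiff a hQ).differentiable (by simp)
  have hd' : ∀ a, DifferentiableAt ℝ (fun x => DD a Q (x, h x)) x := fun a =>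
    DifferentiableAt.comp (f := fun x => (x, h x)) x (hd a _) (by fun_prop)
  have hp : DifferentiableAt ℝ (pder j h) x := (pder_contDiff j hsm).differentiable (by simp) x
  have := pder_add i (hd' (some j)) (hp.mul (hd' none))
  have e : pder i (fun x => pder j h x * DD none Q (x, h x)) x = _ := pder_mul i hp (hd' none)
  simp only [Pi.mul_apply, Pi.mul_def] at this
  rw [h0, pder_const, e, pder_comp_graph0 i hhd x (hd _ _), pder_comp_graph0 i hhd x (hd _ _)] at this
  linarith

lemma flux_boundary {h : EuclideanSpace ℝ (Fin d) → ℝ} (hsm : ContDiff ℝ (⊤ : ℕ∞) h)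
    {Q : EuclideanSpace ℝ (Fin d) × ℝ → ℝ} (hQ : ContDiff ℝ (⊤ : ℕ∞) Q)
    (hbd : ∀ x, Q (x, h x) = 0) (x : EuclideanSpace ℝ (Fin d))
    (hq : DD none Q (x, h x) < 0) (htr : ∑ a, DD a (DD a Q) (x, h x) = 0) :
    flux h (XX Q) x 0 = curvature h x * (DD none Q (x, h x) * rr h x ^ 2) := by
  have hr := rr_pos h x
  have hr2 : rr h x ^ 2 = 1 + ∑ i, (pder i h x) ^ 2 := Real.sq_sqrt (rr_arg_pos h x).le
  have key := flux_alg (fun i => pder i h x) (fun i j => pder i (pder j h) x)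
    (fun a b => DD a (DD b Q) (x, h x)) (DD none Q (x, h x)) (rr h x) hq.ne hr hr2
    (fun a b => DD_comm a b hQ _) htr (fun i j => boundary_second hsm hQ hbd i j x)
  rw [curvature_eq hsm, key]
  have ht : ∀ j, DD (some j) Q (x, h x) = -(pder j h x * DD none Q (x, h x)) := fun j => by
    linarith [boundary_tangent hsm hQ hbd j x]
  have hG : Real.sqrt (GG Q (x, h x)) = -DD none Q (x, h x) * rr h x := by
    have : GG Q (x, h x) = (-DD none Q (x, h x) * rr h x) ^ 2 := by
      rw [mul_pow, hr2]
      simp only [GG, Fintype.sum_option, ht, neg_sq, mul_pow, ← Finset.sum_mul]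
      ring
    rw [this, Real.sqrt_sq]
    exact mul_nonneg (by linarith) hr.le
  simp only [flux, add_zero, XX, hG, NN, Fintype.sum_option, ht]
end

/-- The key identity for `J(h) = ∫ κ G(h)h dx` (Proposition `P:Positive2`):
`J(h)` equals the integral over the fluid domain `Ω = {y < h(x)}` of
`(|∇Q|²|∇²Q|² − |∇Q·∇∇Q|²)/|∇Q|³` where `Q = φ − y` is the pressure; in
particular `J(h) ≥ 0`. -/
theorem J_eq_pressure_integral (d : ℕ) (hd : 1 ≤ d)
    (h : EuclideanSpace ℝ (Fin d) → ℝ)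
    (hsm : ContDiff ℝ (⊤ : ℕ∞) h)
    (hper : ZPeriodic h)
    (φ : EuclideanSpace ℝ (Fin d) × ℝ → ℝ)
    (hφsm : ContDiff ℝ (⊤ : ℕ∞) φ)
    (hφper : ZPeriodicX φ)
    (hφharm : ∀ p : EuclideanSpace ℝ (Fin d) × ℝ, p.2 < h p.1 →
      (∑ i, pdx i (pdx i φ) p) + pdy (pdy φ) p = 0)
    (hφbd : ∀ x, φ (x, h x) = h x)
    (hφint : ∀ n : ℕ, 0 < n →
      IntegrableOn (fun p => ‖iteratedFDeriv ℝ n φ p‖ ^ 2)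
        {p : EuclideanSpace ℝ (Fin d) × ℝ | p.1 ∈ fundDom d ∧ p.2 < h p.1})
    (hφdecay : ∀ n : ℕ, 0 < n → ∀ ε > 0, ∃ Y : ℝ,
      ∀ (x : EuclideanSpace ℝ (Fin d)) (y : ℝ), y ≤ Y →
        ‖iteratedFDeriv ℝ n φ (x, y)‖ ≤ ε) :
    (∫ x in fundDom d, curvature h x * DtNh h φ x)
      = (∫ p in {p : EuclideanSpace ℝ (Fin d) × ℝ |
            p.1 ∈ fundDom d ∧ p.2 < h p.1},
          (fullGradSq (fun q => φ q - q.2) p * fullHessSq (fun q => φ q - q.2) p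
            - gradDotHessSq (fun q => φ q - q.2) p)
          / Real.sqrt (fullGradSq (fun q => φ q - q.2) p) ^ 3)
    ∧ 0 ≤ ∫ x in fundDom d, curvature h x * DtNh h φ x := by
  set Q : EuclideanSpace ℝ (Fin d) × ℝ → ℝ := fun q => φ q - q.2 with hQdef
  have hQ : ContDiff ℝ (⊤ : ℕ∞) Q := hφsm.sub contDiff_snd
  have hQp : ZPeriodicX Q := by
    intro x y k
    simp only [hQdef, hφper x y k]
  have hφd : Differentiable ℝ φ := hφsm.differentiable (by simp)
  have hD1 : ∀ a, DD a Q = fun p => DD a φ p - (ee d a).2 := by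
    intro a; funext p
    rw [hQdef, DD_sub a (hφd p) differentiableAt_snd, DD_snd]
  have hD2 : ∀ a b, DD a (DD b Q) = DD a (DD b φ) := by
    intro a b; funext p
    rw [hD1 b, DD_sub a ((DD_contDiff b hφsm).differentiable (by simp) p) (differentiableAt_const _),
      DD_const, sub_zero]
  have hn1 : ∀ p, DD none Q p = DD none φ p - 1 := by
    intro p; rw [hD1]; rfl
  have hs1 : ∀ i p, DD (some i) Q p = DD (some i) φ p := by
    intro i p; rw [hD1]; show _ - 0 = _; rw [sub_zero]
  have hharm : ∀ p : EuclideanSpace ℝ (Fin d) × ℝ, p.2 < h p.1 → ∑ a, DD a (DD a Q) p = 0 := by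
    intro p hp
    simp only [hD2, Fintype.sum_option]
    rw [add_comm]
    exact hφharm p hp
  have hbd : ∀ x, Q (x, h x) = 0 := fun x => by simp only [hQdef, hφbd, sub_self]
  obtain ⟨Y1, hY1⟩ := hφdecay 1 one_pos (1/2) (by norm_num)
  obtain ⟨c, hc, hcb⟩ := vertical_bound hsm hper hQ hQp hharm hbd Y1 (by
    intro x y hy
    have h1 := (DD_le none φ (x, y)).trans (hY1 x y hy)
    rw [hn1]
    linarith [le_abs_self (DD none φ (x, y))])
  have hneg : ∀ x y, y ≤ h x → DD none Q (x, y) < 0 := fun x y hy => by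
    linarith [hcb x y hy]
  have hGne : ∀ x y, y ≤ h x → GG Q (x, y) ≠ 0 := by
    intro x y hy
    have h1 : (DD none Q (x, y)) ^ 2 ≤ GG Q (x, y) :=
      Finset.single_le_sum (f := fun b => (DD b Q (x, y)) ^ 2) (fun _ _ => sq_nonneg _)
        (Finset.mem_univ none)
    have h2 : 0 < (DD none Q (x, y)) ^ 2 := by
      have := (hneg x y hy).ne
      positivity
    linarith
  have hharm' : ∀ x y, y ≤ h x → ∑ a, DD a (DD a Q) (x, y) = 0 :=
    fun x y hy => zero_ext (g := fun p => ∑ a, DD a (DD a Q) p)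
      (continuous_finsetSum _ fun a _ => (DD_contDiff a (DD_contDiff a hQ)).continuous) hharm x y hy
  have hlap : ∀ b x y, y ≤ h x → ∑ a, DD a (DD a (DD b Q)) (x, y) = 0 :=
    fun b x y hy => zero_ext (g := fun p => ∑ a, DD a (DD a (DD b Q)) p)
      (continuous_finsetSum _ fun a _ =>
        (DD_contDiff a (DD_contDiff a (DD_contDiff b hQ))).continuous)
      (lap_DD_zero b hQ hsm.continuous hharm) x y hy
  have hdiv : ∀ x y, y ≤ h x → divX (XX Q) (x, y) =
      (fullGradSq Q (x, y) * fullHessSq Q (x, y) - gradDotHessSq Q (x, y))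
        / Real.sqrt (fullGradSq Q (x, y)) ^ 3 :=
    fun x y hy => divX_XX hQ (hGne x y hy) (fun b => hlap b x y hy)
  obtain ⟨H, hH0, hH⟩ := periodic_bdd hsm.continuous hper
  choose K hK0 hK using fun i => periodic_bdd (pder_contDiff i hsm).continuous
    (pder_periodic i hper)
  have hdec : ∀ ε > 0, ∃ S : ℝ, ∀ s ≤ S, ∀ x, |flux h (XX Q) x s| ≤ ε := by
    intro ε hε
    set N : ℝ := ∑ _b : Option (Fin d), (1 : ℝ) with hN
    have hNn : 0 ≤ N := Finset.sum_nonneg fun _ _ => zero_le_one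
    set T : ℝ := ∑ i, K i with hT
    have hTn : 0 ≤ T := Finset.sum_nonneg fun i _ => (hK0 i).le
    set δ : ℝ := ε / ((N + 1) * (1 + T)) with hδ
    have hδ0 : 0 < δ := by positivity
    obtain ⟨Y, hY⟩ := hφdecay 2 two_pos δ hδ0
    refine ⟨Y - H, fun s hs x => ?_⟩
    have hy : h x + s ≤ Y := by linarith [(abs_le.1 (hH x)).2]
    have hXb : ∀ a, |XX Q a (x, h x + s)| ≤ N * δ := by
      intro a
      refine (XX_le Q a _).trans ?_
      rw [hN, Finset.sum_mul]
      refine Finset.sum_le_sum fun b _ => ?_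
      rw [hD2, one_mul]
      exact (DD_DD_le a b hφsm _).trans (hY x _ hy)
    have h1 : |∑ i, pder i h x * XX Q (some i) (x, h x + s)| ≤ T * (N * δ) := by
      refine (Finset.abs_sum_le_sum_abs _ _).trans ?_
      rw [hT, Finset.sum_mul]
      refine Finset.sum_le_sum fun i _ => ?_
      rw [abs_mul]
      exact mul_le_mul (hK i x) (hXb _) (abs_nonneg _) (hK0 i).le
    have h2 : |flux h (XX Q) x s| ≤ N * δ + T * (N * δ) :=
      (abs_sub _ _).trans (add_le_add (hXb none) h1)
    have h3 : (N + 1) * (1 + T) * δ = ε := by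
      rw [hδ]; field_simp
    have h4 : 0 ≤ (1 + T) * δ := by positivity
    nlinarith
  have hfull := full_div hsm hper (X := XX Q)
    (fun a x y hy => XX_contDiffAt hQ a (hGne x y hy)) (XX_periodic hQp)
    (fun x y hy => by rw [hdiv x y hy]; exact integrand_nonneg Q _) hdec
  have hms : MeasurableSet {p : EuclideanSpace ℝ (Fin d) × ℝ | p.1 ∈ fundDom d ∧ p.2 < h p.1} :=
    (measurable_fst (fundDom_measurable d)).inter
      (measurableSet_lt measurable_snd (hsm.continuous.measurable.comp measurable_fst))
  have hI : (∫ p in {p : EuclideanSpace ℝ (Fin d) × ℝ | p.1 ∈ fundDom d ∧ p.2 < h p.1},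
      (fullGradSq Q p * fullHessSq Q p - gradDotHessSq Q p)
          / Real.sqrt (fullGradSq Q p) ^ 3) = ∫ x in fundDom d, flux h (XX Q) x 0 := by
    rw [← hfull]
    refine setIntegral_congr_fun hms fun p hp => ?_
    exact (hdiv p.1 p.2 hp.2.le).symm
  have hpt : ∀ x, curvature h x * DtNh h φ x = curvature h x + flux h (XX Q) x 0 := by
    intro x
    rw [flux_boundary hsm hQ hbd x (hneg x _ le_rfl) (hharm' x _ le_rfl)]
    have hr2 : rr h x ^ 2 = 1 + ∑ i, (pder i h x) ^ 2 := Real.sq_sqrt (rr_arg_pos h x).le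
    have e : DtNh h φ x = 1 + DD none Q (x, h x) * rr h x ^ 2 := by
      have e1 : pdy φ (x, h x) = DD none Q (x, h x) + 1 := by
        rw [hn1]; show DD none φ (x, h x) = _; ring
      have e2 : ∀ i, pder i h x * pdx i φ (x, h x) = -(DD none Q (x, h x)) * (pder i h x) ^ 2 := by
        intro i
        have : pdx i φ (x, h x) = DD (some i) Q (x, h x) := by rw [hs1]; rfl
        rw [this]
        have := boundary_tangent hsm hQ hbd i x
        have e3 : DD (some i) Q (x, h x) = -(pder i h x * DD none Q (x, h x)) := by linarith
        rw [e3]; ring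
      unfold DtNh
      simp only [e1, e2]
      rw [← Finset.mul_sum, hr2]; ring
    rw [e]; ring
  have hcI : IntegrableOn (curvature h) (fundDom d) :=
    ((curvature_continuous hsm).continuousOn.integrableOn_compact (cube_compact d)).mono_set
      (fundDom_subset_cube d)
  have hfI : IntegrableOn (fun x => flux h (XX Q) x 0) (fundDom d) := by
    have : (fun x => flux h (XX Q) x 0)
        = fun x => curvature h x * (DD none Q (x, h x) * rr h x ^ 2) :=
      funext fun x => flux_boundary hsm hQ hbd x (hneg x _ le_rfl) (hharm' x _ le_rfl)
    rw [this]
    have hc1 : Continuous (fun x => DD none Q (x, h x)) :=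
      (DD_contDiff none hQ).continuous.comp (continuous_id.prodMk hsm.continuous)
    have : Continuous (fun x => curvature h x * (DD none Q (x, h x) * rr h x ^ 2)) :=
      (curvature_continuous hsm).mul (hc1.mul ((rr_contDiff hsm).continuous.pow 2))
    exact (this.continuousOn.integrableOn_compact (cube_compact d)).mono_set
      (fundDom_subset_cube d)
  have main : (∫ x in fundDom d, curvature h x * DtNh h φ x)
      = ∫ p in {p : EuclideanSpace ℝ (Fin d) × ℝ | p.1 ∈ fundDom d ∧ p.2 < h p.1},
      (fullGradSq Q p * fullHessSq Q p - gradDotHessSq Q p)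
          / Real.sqrt (fullGradSq Q p) ^ 3 := by
    rw [hI]
    simp only [hpt]
    rw [integral_add hcI hfI, curvature_integral hsm hper, zero_add]
  refine ⟨main, ?_⟩
  rw [main]
  exact integral_nonneg fun p => integrand_nonneg Q p
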